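/- In the discharging of H defined by rules R1–R5 applied to the initial charge (every j-face charged with weight j), every minor 2-face f of H has final weight w(f) ≥ 10/3. -/

import Mathlib

open scoped Classical

noncomputable section

/-- A plane embedding (drawing) of a simple graph: vertices are mapped to distinct
points of the plane, every edge is drawn as a simple arc joining the points of its two
endvertices, arcs contain no vertex points other than their endpoints, and two distinct
arcs meet only in common endpoints. -/
structure PlaneEmbedding {V : Type*} (G : SimpleGraph V) where
  pos : V → ℝ × ℝ
  arc : V → V → Set (ℝ × ℝ)
  pos_injective : Function.Injective pos
  arc_symm : ∀ u v, arc u v = arc v u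
  arc_curve : ∀ u v, G.Adj u v → ∃ γ : ℝ → ℝ × ℝ,
      ContinuousOn γ (Set.Icc 0 1) ∧ Set.InjOn γ (Set.Icc 0 1) ∧
      γ 0 = pos u ∧ γ 1 = pos v ∧ γ '' Set.Icc 0 1 = arc u v
  arc_vertex : ∀ u v, G.Adj u v → ∀ w, pos w ∈ arc u v → w = u ∨ w = v
  arc_inter : ∀ u v x y, G.Adj u v → G.Adj x y → s(u, v) ≠ s(x, y) →
      arc u v ∩ arc x y ⊆ Set.range pos

/-- A graph is planar if it admits a plane embedding. -/
def SimpleGraph.IsPlanar {V : Type*} (G : SimpleGraph V) : Prop :=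
  Nonempty (PlaneEmbedding G)

/-- A graph is 3-connected if it has at least four vertices and deleting any set of at
most two vertices leaves a connected graph. -/
def ThreeConnected {V : Type*} [Fintype V] (G : SimpleGraph V) : Prop :=
  4 ≤ Fintype.card V ∧
    ∀ S : Finset V, S.card ≤ 2 → (G.induce ((↑S : Set V)ᶜ)).Connected

/-- `S` is a separator of `G`: deleting it leaves a disconnected graph. -/
def IsSeparator {V : Type*} [Fintype V] (G : SimpleGraph V) (S : Finset V) : Prop :=
  ¬ (G.induce ((↑S : Set V)ᶜ)).Connected

/-- A separator `S` is trivial if some component of `G - S` is a single vertex, i.e.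
some vertex outside `S` has all of its neighbours inside `S`. -/
def TrivialSeparator {V : Type*} [Fintype V] (G : SimpleGraph V) (S : Finset V) : Prop :=
  ∃ v : V, v ∉ S ∧ ∀ w : V, G.Adj v w → w ∈ S

/-- A graph is essentially 4-connected if it is 3-connected and every 3-separator is
trivial. -/
def EssentiallyFourConnected {V : Type*} [Fintype V] (G : SimpleGraph V) : Prop :=
  ThreeConnected G ∧
    ∀ S : Finset V, S.card = 3 → IsSeparator G S → TrivialSeparator G S

/-- A cycle `C` of `G` is isolating if every component of `G - V(C)` is a single vertex
of degree 3 in `G`, i.e. every vertex not on `C` has degree 3 in `G` and all of its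
neighbours on `C`. -/
def IsIsolating {V : Type*} [Fintype V] (G : SimpleGraph V) {x : V} (C : G.Walk x x) : Prop :=
  ∀ v : V, v ∉ C.support →
    (Finset.univ.filter fun w => G.Adj v w).card = 3 ∧ ∀ w : V, G.Adj v w → w ∈ C.support

/-- `C` is a longest isolating cycle of `G`. -/
def IsLongestIsolatingCycle {V : Type*} [Fintype V] (G : SimpleGraph V) {x : V}
    (C : G.Walk x x) : Prop :=
  C.IsCycle ∧ IsIsolating G C ∧
    ∀ (y : V) (C' : G.Walk y y), C'.IsCycle → IsIsolating G C' → C'.length ≤ C.length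

section PlaneSetup

variable {V : Type*} [Fintype V] {G : SimpleGraph V}

/-- The chords of the cycle `C`: edges of `G` not on `C` joining two vertices of `C`. -/
def chordSet {x : V} (C : G.Walk x x) : Set (Sym2 V) :=
  {e | e ∈ G.edgeSet ∧ e ∉ C.edges ∧ ∀ v ∈ e, v ∈ C.support}

/-- The plane graph `H` obtained from `G` by deleting all chords of `C`. -/
def Hgraph {x : V} (C : G.Walk x x) : SimpleGraph V :=
  G.deleteEdges (chordSet C)

/-- The arc drawing an edge, as a function of the unordered edge. -/
def arcSet (emb : PlaneEmbedding G) : Sym2 V → Set (ℝ × ℝ) :=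
  Sym2.lift ⟨emb.arc, emb.arc_symm⟩

/-- The point set of the drawing of the subgraph of `H'` induced on the vertex set `s`
(in the embedding `emb` of `G`). -/
def drawingOn (emb : PlaneEmbedding G) (H' : SimpleGraph V) (s : Set V) : Set (ℝ × ℝ) :=
  emb.pos '' s ∪
    ⋃ (u : V) (v : V) (_ : H'.Adj u v) (_ : u ∈ s) (_ : v ∈ s), emb.arc u v

/-- The drawing of `H`. -/
def drawingH (emb : PlaneEmbedding G) {x : V} (C : G.Walk x x) : Set (ℝ × ℝ) :=
  drawingOn emb (Hgraph C) Set.univ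

/-- `f` is a face of the drawing `D`: a connected component of its complement. -/
def IsFaceOf (D : Set (ℝ × ℝ)) (f : Set (ℝ × ℝ)) : Prop :=
  ∃ z : ℝ × ℝ, z ∉ D ∧ f = connectedComponentIn Dᶜ z

/-- The drawing of the cycle `C`. -/
def drawC (emb : PlaneEmbedding G) {x : V} (C : G.Walk x x) : Set (ℝ × ℝ) :=
  ⋃ e ∈ C.edges, arcSet emb e

/-- The open region strictly inside the closed curve given by `C`: the points off the
curve whose connected component in the complement is bounded. -/
def insideC (emb : PlaneEmbedding G) {x : V} (C : G.Walk x x) : Set (ℝ × ℝ) :=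
  {z | z ∉ drawC emb C ∧ Bornology.IsBounded (connectedComponentIn (drawC emb C)ᶜ z)}

/-- The vertices of `G` strictly inside `C`. -/
def Vminus (emb : PlaneEmbedding G) {x : V} (C : G.Walk x x) : Finset V :=
  Finset.univ.filter fun v => v ∉ C.support ∧ emb.pos v ∈ insideC emb C

/-- The vertices of `G` strictly outside `C`:  `V⁺ = V - V(C) - V⁻`. -/
def Vplus (emb : PlaneEmbedding G) {x : V} (C : G.Walk x x) : Finset V :=
  Finset.univ.filter fun v => v ∉ C.support ∧ v ∉ Vminus emb C

/-- A face `f` is incident with the vertex `v`. -/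
def incVertex (emb : PlaneEmbedding G) (f : Set (ℝ × ℝ)) (v : V) : Prop :=
  emb.pos v ∈ closure f

/-- A face `f` is incident with the edge `e` (the arc of `e` lies on the boundary). -/
def incEdge (emb : PlaneEmbedding G) (f : Set (ℝ × ℝ)) (e : Sym2 V) : Prop :=
  arcSet emb e ⊆ closure f

/-- A minor face of the drawing `D`: a face incident with exactly one vertex of
`V⁻ ∪ V⁺`. -/
def MinorFaceOf (emb : PlaneEmbedding G) {x : V} (C : G.Walk x x)
    (D : Set (ℝ × ℝ)) (f : Set (ℝ × ℝ)) : Prop :=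
  IsFaceOf D f ∧ ∃! v : V, v ∈ Vminus emb C ∪ Vplus emb C ∧ incVertex emb f v

/-- `M⁻`: the minor faces of `H⁻ = H - V⁺`. -/
def Mminus (emb : PlaneEmbedding G) {x : V} (C : G.Walk x x) : Set (Set (ℝ × ℝ)) :=
  {f | MinorFaceOf emb C (drawingOn emb (Hgraph C) ((↑(Vplus emb C) : Set V)ᶜ)) f}

/-- `M⁺`: the minor faces of `H⁺ = H - V⁻`. -/
def Mplus (emb : PlaneEmbedding G) {x : V} (C : G.Walk x x) : Set (Set (ℝ × ℝ)) :=
  {f | MinorFaceOf emb C (drawingOn emb (Hgraph C) ((↑(Vminus emb C) : Set V)ᶜ)) f}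

/-- A minor face of `H`. -/
def MinorFaceH (emb : PlaneEmbedding G) {x : V} (C : G.Walk x x) (f : Set (ℝ × ℝ)) : Prop :=
  MinorFaceOf emb C (drawingH emb C) f

/-- A major face of `H`: a face of `H` that is not minor. -/
def MajorFaceH (emb : PlaneEmbedding G) {x : V} (C : G.Walk x x) (f : Set (ℝ × ℝ)) : Prop :=
  IsFaceOf (drawingH emb C) f ∧ ¬ MinorFaceH emb C f

/-- The number of `C`-edges of a face `f` (so `f` is a `j`-face when this equals `j`). -/
def numCEdges (emb : PlaneEmbedding G) {x : V} (C : G.Walk x x) (f : Set (ℝ × ℝ)) : ℕ :=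
  (C.edges.toFinset.filter fun e => incEdge emb f e).card

/-- `m_{f,f'}`: the number of common `C`-edges of the faces `f` and `f'`. -/
def mEdges (emb : PlaneEmbedding G) {x : V} (C : G.Walk x x)
    (f f' : Set (ℝ × ℝ)) : ℕ :=
  (C.edges.toFinset.filter fun e => incEdge emb f e ∧ incEdge emb f' e).card

/-- `f'` is opposite to `f` (with respect to some `C`-edge incident with both). -/
def OppositeFaces (emb : PlaneEmbedding G) {x : V} (C : G.Walk x x)
    (f f' : Set (ℝ × ℝ)) : Prop :=
  f ≠ f' ∧ ∃ e ∈ C.edges, incEdge emb f e ∧ incEdge emb f' e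

/-- `e` is the middle `C`-edge of the face `f` (for a 3-face, the `C`-edge sharing an
endvertex with every other `C`-edge of `f`). -/
def IsMiddleCEdge (emb : PlaneEmbedding G) {x : V} (C : G.Walk x x)
    (f : Set (ℝ × ℝ)) (e : Sym2 V) : Prop :=
  e ∈ C.edges ∧ incEdge emb f e ∧
    ∀ e' ∈ C.edges, incEdge emb f e' → e' ≠ e → ∃ v : V, v ∈ e ∧ v ∈ e'

/-- The total weight sent from the face `f` to the face `f'` by the discharging rules
R1–R5 (each rule applied exactly once). -/
def sendWeight (emb : PlaneEmbedding G) {x : V} (C : G.Walk x x)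
    (f f' : Set (ℝ × ℝ)) : ℚ :=
  -- R1: a major face sends `m_{f,f'}` to every opposite minor face
  (if MajorFaceH emb C f ∧ MinorFaceH emb C f' ∧ OppositeFaces emb C f f'
    then (mEdges emb C f f' : ℚ) else 0)
  -- R2: a minor face sends `(2/3)·m_{f,f'}` to every opposite minor 2-face
  + (if MinorFaceH emb C f ∧ MinorFaceH emb C f' ∧ numCEdges emb C f' = 2 ∧
        OppositeFaces emb C f f'
    then 2 / 3 * (mEdges emb C f f' : ℚ) else 0)
  -- R3: a minor face sends 1 to every minor 3-face opposite with respect to its middle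
  -- `C`-edge
  + (if MinorFaceH emb C f ∧ MinorFaceH emb C f' ∧ numCEdges emb C f' = 3 ∧ f ≠ f' ∧
        (∃ e : Sym2 V, IsMiddleCEdge emb C f' e ∧ incEdge emb f e)
    then 1 else 0)
  -- R4
  + (if MinorFaceH emb C f ∧ 4 ≤ numCEdges emb C f ∧ MinorFaceH emb C f' ∧
        numCEdges emb C f' = 4 ∧ OppositeFaces emb C f' f ∧ mEdges emb C f' f = 2 ∧
        (∃ f₂ : Set (ℝ × ℝ), MinorFaceH emb C f₂ ∧
          (numCEdges emb C f₂ = 2 ∨ numCEdges emb C f₂ = 3) ∧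
          OppositeFaces emb C f' f₂ ∧ mEdges emb C f' f₂ = 2)
    then 2 / 3 else 0)
  -- R5
  + (if MinorFaceH emb C f ∧ 4 ≤ numCEdges emb C f ∧ MinorFaceH emb C f' ∧
        numCEdges emb C f' = 5 ∧ OppositeFaces emb C f' f ∧ mEdges emb C f' f = 2 ∧
        (∃ g₁ g₂ : Set (ℝ × ℝ), g₁ ≠ g₂ ∧
          MinorFaceH emb C g₁ ∧ numCEdges emb C g₁ = 2 ∧ OppositeFaces emb C f' g₁ ∧
          MinorFaceH emb C g₂ ∧ numCEdges emb C g₂ = 2 ∧ OppositeFaces emb C f' g₂)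
    then 1 / 3 else 0)

/-- The final weight of a face `f` after discharging: the initial charge `j` of a
`j`-face, minus everything sent, plus everything received. -/
def wFace (emb : PlaneEmbedding G) {x : V} (C : G.Walk x x) (f : Set (ℝ × ℝ)) : ℚ :=
  (numCEdges emb C f : ℚ) - (∑ᶠ f' : Set (ℝ × ℝ), sendWeight emb C f f')
    + ∑ᶠ f' : Set (ℝ × ℝ), sendWeight emb C f' f

end PlaneSetup

namespace PlaneTopology

open Set Topology

/-- `h` has a continuous logarithm on `s`. -/
def HasLog (h : ℂ → ℂ) (s : Set ℂ) : Prop :=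
  ∃ g : ℂ → ℂ, ContinuousOn g s ∧ ∀ z ∈ s, Complex.exp (g z) = h z

theorem HasLog.mono {h : ℂ → ℂ} {s t : Set ℂ} (H : HasLog h t) (hst : s ⊆ t) : HasLog h s := by
  obtain ⟨g, hg, hgh⟩ := H
  exact ⟨g, hg.mono hst, fun z hz => hgh z (hst hz)⟩

theorem hasLog_univ {h : ℂ → ℂ} (hc : Continuous h) (h0 : ∀ z, h z ≠ 0) : HasLog h univ := by
  obtain ⟨f, ⟨-, hf⟩, -⟩ := Complex.isCoveringMapOn_exp.existsUnique_continuousMap_lifts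
    (A := ℂ) ⟨h, hc⟩ (a₀ := 0) (Complex.exp_log (h0 0)) h0
  exact ⟨f, f.continuous.continuousOn, fun z _ => congrFun hf z⟩

theorem log_unique {s : Set ℂ} (hs : IsPreconnected s) {g₁ g₂ : ℂ → ℂ}
    (h₁ : ContinuousOn g₁ s) (h₂ : ContinuousOn g₂ s)
    (he : ∀ z ∈ s, Complex.exp (g₁ z) = Complex.exp (g₂ z)) :
    ∃ n : ℤ, ∀ z ∈ s, g₁ z = g₂ z + n * (2 * Real.pi * Complex.I) := by
  have hpi : (2 * Real.pi * Complex.I : ℂ) ≠ 0 := Complex.two_pi_I_ne_zero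
  have key : ∀ z ∈ s, ∃ n : ℤ, g₁ z = g₂ z + n * (2 * Real.pi * Complex.I) :=
    fun z hz => Complex.exp_eq_exp_iff_exists_int.1 (he z hz)
  have hd : IsDiscrete (range (Int.cast : ℤ → ℝ)) :=
    Int.isClosedEmbedding_coe_real.isEmbedding.isDiscrete_range
  obtain ⟨y, ⟨n, rfl⟩, hn⟩ := hs.eqOn_const_of_mapsTo hd
    (f := fun z => ((g₁ z - g₂ z) / (2 * Real.pi * Complex.I)).re)
    (Complex.continuous_re.comp_continuousOn ((h₁.sub h₂).div_const _))
    (fun z hz => by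
      obtain ⟨n, hn⟩ := key z hz
      refine ⟨n, ?_⟩
      simp only [hn, add_sub_cancel_left]
      rw [mul_div_cancel_right₀ _ hpi]
      simp)
    ⟨0, 0, by simp⟩
  refine ⟨n, fun z hz => ?_⟩
  obtain ⟨m, hm⟩ := key z hz
  have := hn hz
  simp only [hm, add_sub_cancel_left, Function.const_apply] at this
  rw [mul_div_cancel_right₀ _ hpi] at this
  have hmn : m = n := by simpa using this
  rw [hm, hmn]

theorem not_hasLog_sphere (a : ℂ) {r : ℝ} (hr : 0 < r) :
    ¬ HasLog (fun z => z - a) (Metric.sphere a r) := by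
  rintro ⟨g, hg, hge⟩
  have hmem : ∀ t : ℂ, (a + r * Complex.exp (t.re * Complex.I)) ∈ Metric.sphere a r := by
    intro t
    simp [Complex.norm_exp_ofReal_mul_I, abs_of_pos hr]
  obtain ⟨n, hn⟩ := log_unique (s := univ) isPreconnected_univ
    (g₁ := fun t => g (a + r * Complex.exp (t.re * Complex.I)))
    (g₂ := fun t => Real.log r + t.re * Complex.I)
    (by
      rw [← continuousOn_univ.symm.eq]
      exact continuousOn_univ.1 (hg.comp (Continuous.continuousOn (by fun_prop)) fun t _ => hmem t))
    (by fun_prop)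
    (fun t _ => by
      rw [hge _ (hmem t), Complex.exp_add, ← Complex.ofReal_exp, Real.exp_log hr]
      ring)
  have h0 := hn 0 trivial
  have h1 := hn ((2 * Real.pi : ℝ) : ℂ) trivial
  simp only [Complex.zero_re, Complex.ofReal_re, Complex.ofReal_zero, zero_mul] at h0 h1
  have e1 : Complex.exp (((2 * Real.pi : ℝ) : ℂ) * Complex.I) = 1 := by
    push_cast; exact Complex.exp_two_pi_mul_I
  rw [e1] at h1
  rw [Complex.exp_zero, h1] at h0
  have : (2 * Real.pi * Complex.I : ℂ) = 0 := by
    push_cast at h0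
    linear_combination h0
  exact Complex.two_pi_I_ne_zero this

/-- A nonvanishing continuous function on the punctured plane is a power times an exponential. -/
theorem exists_zpow_mul_exp {h : ℂ → ℂ} (hc : ContinuousOn h {0}ᶜ) (h0 : ∀ z ≠ 0, h z ≠ 0) :
    ∃ k : ℤ, HasLog (fun z => h z * z ^ k) {0}ᶜ := by
  obtain ⟨g, hg, hge⟩ := hasLog_univ (h := fun w => h (Complex.exp w))
    (continuousOn_univ.1 (hc.comp Complex.continuous_exp.continuousOn
      fun w _ => Complex.exp_ne_zero w)) (fun w => h0 _ (Complex.exp_ne_zero w))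
  rw [continuousOn_univ] at hg
  obtain ⟨n, hn⟩ := log_unique (s := univ) isPreconnected_univ
    (g₁ := fun w => g (w + 2 * Real.pi * Complex.I)) (g₂ := g)
    (Continuous.continuousOn (by fun_prop)) hg.continuousOn
    (fun w _ => by
      rw [hge _ trivial, hge _ trivial]
      simp only [Complex.exp_add, Complex.exp_two_pi_mul_I, mul_one])
  set p : ℂ → ℂ := fun w => g w - n * w with hp
  have hpc : Continuous p := by fun_prop
  have per : Function.Periodic p (2 * Real.pi * Complex.I) := by
    intro w
    simp only [hp, hn w trivial]
    ring
  have hpeq : ∀ u v : ℂ, Complex.exp u = Complex.exp v → p u = p v := by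
    intro u v huv
    obtain ⟨m, rfl⟩ := Complex.exp_eq_exp_iff_exists_int.1 huv
    exact per.int_mul m v
  refine ⟨-n, fun z => p (Complex.log z), ?_, fun z hz => ?_⟩
  · refine continuousOn_of_forall_continuousAt fun z hz => ?_
    have hz : z ≠ 0 := hz
    rcases Complex.mem_slitPlane_or_neg_mem_slitPlane hz with hs | hs
    · exact hpc.continuousAt.comp (continuousAt_clog hs)
    · have : ContinuousAt (fun w => p (Complex.log (-w) + Real.pi * Complex.I)) z :=
        hpc.continuousAt.comp (((continuousAt_clog hs).comp continuous_neg.continuousAt).add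
          continuousAt_const)
      refine this.congr ?_
      filter_upwards [isOpen_ne.mem_nhds hz] with w hw
      refine hpeq _ _ ?_
      rw [Complex.exp_add, Complex.exp_pi_mul_I, Complex.exp_log (neg_ne_zero.2 hw),
        Complex.exp_log hw]
      ring
  · have hz : z ≠ 0 := hz
    have h1 := hge (Complex.log z) trivial
    simp only [Complex.exp_log hz] at h1
    simp only [hp]
    rw [Complex.exp_sub, h1, Complex.exp_int_mul, Complex.exp_log hz, zpow_neg, div_eq_mul_inv]

/-- A nonvanishing function with a logarithm off a compact set can be normalised near infinity. -/
theorem HasLog.exists_normalisation {h : ℂ → ℂ} {e : Set ℂ} (he : IsCompact e)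
    (H : HasLog h eᶜ) :
    ∃ (p : ℂ → ℂ) (R : ℝ), Continuous p ∧ ∀ z, R ≤ ‖z‖ → h z * Complex.exp (p z) = 1 := by
  obtain ⟨B, hB, hBe⟩ := H
  obtain ⟨R, hR⟩ := he.isBounded.subset_ball 0
  refine ⟨fun z => -(((max 0 (min 1 (‖z‖ - R)) : ℝ) : ℂ) * B z), R + 1, ?_, fun z hz => ?_⟩
  · refine continuous_iff_continuousAt.2 fun z => ?_
    by_cases hz : ‖z‖ < R
    · have : ContinuousAt (fun _ : ℂ => (0 : ℂ)) z := continuousAt_const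
      refine this.congr ?_
      filter_upwards [(isOpen_lt continuous_norm continuous_const).mem_nhds hz] with w hw
      have hw : ‖w‖ < R := hw
      rw [max_eq_left ((min_le_right _ _).trans (by linarith))]
      simp
    · have hze : z ∈ eᶜ := fun h => hz (by simpa using hR h)
      have := hB.continuousAt (he.isClosed.isOpen_compl.mem_nhds hze)
      exact ((by fun_prop : ContinuousAt (fun z : ℂ =>
        ((max 0 (min 1 (‖z‖ - R)) : ℝ) : ℂ)) z).mul this).neg
  · have hze : z ∈ eᶜ := fun h => by
      have : ‖z‖ < R := by simpa using hR h
      linarith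
    have h1 : max 0 (min 1 (‖z‖ - R)) = 1 := by
      rw [min_eq_left (by linarith), max_eq_right zero_le_one]
    simp only [h1]
    rw [← hBe z hze, ← Complex.exp_add]
    simp

theorem HasLog.compl_singleton {h : ℂ → ℂ} {e : Set ℂ} {a : ℂ} (he : IsCompact e)
    (H : HasLog h eᶜ) (hc : ContinuousOn h {a}ᶜ) (h0 : ∀ z ≠ a, h z ≠ 0) : HasLog h {a}ᶜ := by
  obtain ⟨p, R, hp, hpR⟩ := H.exists_normalisation he
  have hne : ∀ w : ℂ, w ≠ 0 → a + w⁻¹ ≠ a := fun w hw => by simpa using hw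
  obtain ⟨g, hg, hge⟩ := hasLog_univ
    (h := fun w => if w = 0 then 1 else h (a + w⁻¹) * Complex.exp (p (a + w⁻¹))) (by
      refine continuous_iff_continuousAt.2 fun w => ?_
      by_cases hw : w = 0
      · subst hw
        refine (continuousAt_const (y := (1 : ℂ))).congr ?_
        have h1 : ∀ᶠ w : ℂ in 𝓝 0, ‖w‖ * (|R| + ‖a‖) < 1 := by
          refine (ContinuousAt.eventually_lt (by fun_prop) continuousAt_const ?_)
          simp
        filter_upwards [h1] with w hw
        split_ifs with hw0
        · rfl
        · refine (hpR _ ?_).symm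
          have hpos : 0 < ‖w‖ := norm_pos_iff.2 hw0
          have h2 : |R| + ‖a‖ < ‖w‖⁻¹ := by
            rw [← one_div, lt_div_iff₀ hpos]; linarith
          have h3 : ‖w⁻¹‖ ≤ ‖a + w⁻¹‖ + ‖a‖ := by
            have := norm_sub_le (a + w⁻¹) a
            simpa using this
          rw [norm_inv] at h3
          linarith [le_abs_self R]
      · refine ContinuousAt.congr (f := fun w => h (a + w⁻¹) * Complex.exp (p (a + w⁻¹))) ?_ ?_
        · have c1 : ContinuousAt (fun w : ℂ => a + w⁻¹) w :=
            continuousAt_const.add (continuousAt_inv₀ hw)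
          have c2 : ContinuousAt h (a + w⁻¹) :=
            hc.continuousAt (isOpen_compl_singleton.mem_nhds (hne w hw))
          exact (ContinuousAt.comp (f := fun w : ℂ => a + w⁻¹) (g := h) c2 c1).mul
            (ContinuousAt.comp (f := fun w : ℂ => a + w⁻¹) (g := fun z => Complex.exp (p z))
              (by fun_prop) c1)
        · filter_upwards [isOpen_ne.mem_nhds hw] with v hv
          rw [if_neg hv]) (fun w => by
      split_ifs with hw
      · exact one_ne_zero
      · exact mul_ne_zero (h0 _ (hne w hw)) (Complex.exp_ne_zero _))
  rw [continuousOn_univ] at hg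
  refine ⟨fun z => g (z - a)⁻¹ - p z, ?_, fun z hz => ?_⟩
  · refine ContinuousOn.sub (hg.comp_continuousOn ?_) hp.continuousOn
    exact ContinuousOn.inv₀ (by fun_prop) fun z hz => sub_ne_zero.2 hz
  · have hz' : z - a ≠ 0 := sub_ne_zero.2 hz
    rw [Complex.exp_sub, hge _ trivial]
    simp only [if_neg (inv_ne_zero hz'), inv_inv, add_sub_cancel]
    exact mul_div_cancel_right₀ _ (Complex.exp_ne_zero _)

theorem HasLog.compl_pair {h : ℂ → ℂ} {e : Set ℂ} {a b : ℂ} (hab : a ≠ b) (he : IsCompact e)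
    (H : HasLog h eᶜ) (hc : ContinuousOn h {a, b}ᶜ) (h0 : ∀ z ∈ ({a, b}ᶜ : Set ℂ), h z ≠ 0) :
    ∃ k : ℤ, HasLog (fun z => h z * ((z - a) / (z - b)) ^ k) {a, b}ᶜ := by
  obtain ⟨p, R, hp, hpR⟩ := H.exists_normalisation he
  have hba : a - b ≠ 0 := sub_ne_zero.2 hab
  set m : ℂ → ℂ := fun w => (a - w * b) / (1 - w) with hm
  have hma : ∀ w ≠ 1, m w - a = w * (a - b) / (1 - w) := fun w hw => by
    have : 1 - w ≠ 0 := sub_ne_zero.2 hw.symm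
    simp only [hm]; field_simp; ring
  have hmb : ∀ w ≠ 1, m w - b = (a - b) / (1 - w) := fun w hw => by
    have : 1 - w ≠ 0 := sub_ne_zero.2 hw.symm
    simp only [hm]; field_simp; ring
  have hne : ∀ w : ℂ, w ≠ 0 → w ≠ 1 → m w ∈ ({a, b}ᶜ : Set ℂ) := fun w hw hw1 => by
    have h1 : 1 - w ≠ 0 := sub_ne_zero.2 hw1.symm
    simp only [mem_compl_iff, mem_insert_iff, mem_singleton_iff, not_or]
    constructor
    · rw [← sub_eq_zero, hma w hw1]; exact div_ne_zero (mul_ne_zero hw hba) h1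
    · rw [← sub_eq_zero, hmb w hw1]; exact div_ne_zero hba h1
  have hop : IsOpen ({a, b}ᶜ : Set ℂ) := (toFinite _).isClosed.isOpen_compl
  obtain ⟨k, g, hg, hge⟩ := exists_zpow_mul_exp
    (h := fun w => if w = 1 then 1 else h (m w) * Complex.exp (p (m w))) (by
      refine continuousOn_of_forall_continuousAt fun w hw0 => ?_
      by_cases hw : w = 1
      · subst hw
        refine (continuousAt_const (y := (1 : ℂ))).congr ?_
        have h1 : ∀ᶠ w : ℂ in 𝓝 1, ‖1 - w‖ * (|R| + ‖b‖) < ‖a - b‖ := by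
          refine (ContinuousAt.eventually_lt (by fun_prop) continuousAt_const ?_)
          simpa using hba
        filter_upwards [h1] with w hw
        split_ifs with hw0
        · rfl
        · refine (hpR _ ?_).symm
          have hpos : 0 < ‖1 - w‖ := norm_pos_iff.2 (sub_ne_zero.2 (Ne.symm hw0))
          have h2 : |R| + ‖b‖ < ‖a - b‖ / ‖1 - w‖ := by
            rw [lt_div_iff₀ hpos]; linarith
          have h3 := norm_sub_le (m w) b
          rw [hmb w hw0, norm_div] at h3
          linarith [le_abs_self R]
      · have hw0 : w ≠ 0 := hw0
        refine ContinuousAt.congr (f := fun w => h (m w) * Complex.exp (p (m w))) ?_ ?_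
        · have c1 : ContinuousAt m w :=
            ContinuousAt.div (by fun_prop) (by fun_prop) (sub_ne_zero.2 (Ne.symm hw))
          have c2 : ContinuousAt h (m w) := hc.continuousAt (hop.mem_nhds (hne w hw0 hw))
          exact (ContinuousAt.comp (g := h) c2 c1).mul
            ((by fun_prop : Continuous fun z => Complex.exp (p z)).continuousAt.comp c1)
        · filter_upwards [isOpen_ne.mem_nhds hw] with v hv
          rw [if_neg hv]) (fun w hw0 => by
      split_ifs with hw
      · exact one_ne_zero
      · exact mul_ne_zero (h0 _ (hne w hw0 hw)) (Complex.exp_ne_zero _))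
  have hz' : ∀ z ∈ ({a, b}ᶜ : Set ℂ), z - a ≠ 0 ∧ z - b ≠ 0 := fun z hz => by
    simp only [mem_compl_iff, mem_insert_iff, mem_singleton_iff, not_or] at hz
    exact ⟨sub_ne_zero.2 hz.1, sub_ne_zero.2 hz.2⟩
  refine ⟨k, fun z => g ((z - a) / (z - b)) - p z, ?_, fun z hz => ?_⟩
  · refine ContinuousOn.sub (hg.comp (ContinuousOn.div (by fun_prop) (by fun_prop)
      fun z hz => (hz' z hz).2) fun z hz => ?_) hp.continuousOn
    exact div_ne_zero (hz' z hz).1 (hz' z hz).2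
  · obtain ⟨h1, h2⟩ := hz' z hz
    have hw1 : (z - a) / (z - b) ≠ 1 := by
      rw [Ne, div_eq_one_iff_eq h2]
      intro h
      exact hab (by linear_combination -h)
    have hmz : m ((z - a) / (z - b)) = z := by
      rw [← sub_eq_zero, ← sub_add_sub_cancel _ b z, hmb _ hw1]
      have : 1 - (z - a) / (z - b) = (a - b) / (z - b) := by field_simp; ring
      rw [this]; field_simp; ring
    rw [Complex.exp_sub, hge _ (div_ne_zero h1 h2)]
    simp only [if_neg hw1, hmz]
    have := Complex.exp_ne_zero (p z)
    field_simp

/-- A two-valued locally constant function on `U ∩ V` is the difference of logarithms, on `U` and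
on `V`, of one nonvanishing function on `U ∪ V`. -/
theorem exists_cocycle {U V : Set ℂ} (hU : IsOpen U) (hV : IsOpen V) (hU' : Uᶜ.Nonempty)
    (hV' : Vᶜ.Nonempty) {φ : ℂ → ℝ} (hφ : ContinuousOn φ (U ∩ V))
    (h01 : ∀ z ∈ U ∩ V, φ z = 0 ∨ φ z = 1) :
    ∃ h A B : ℂ → ℂ, ContinuousOn h (U ∪ V) ∧ (∀ z, h z ≠ 0) ∧
      ContinuousOn A U ∧ ContinuousOn B V ∧ (∀ z ∈ U, Complex.exp (A z) = h z) ∧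
      (∀ z ∈ V, Complex.exp (B z) = h z) ∧
      ∀ z ∈ U ∩ V, A z - B z = 2 * Real.pi * Complex.I * φ z := by
  set dU : ℂ → ℝ := fun z => Metric.infDist z Uᶜ with hdU
  set dV : ℂ → ℝ := fun z => Metric.infDist z Vᶜ with hdV
  have cU : Continuous dU := Metric.continuous_infDist_pt _
  have cV : Continuous dV := Metric.continuous_infDist_pt _
  have pU : ∀ z ∈ U, 0 < dU z := fun z hz =>
    (hU.isClosed_compl.notMem_iff_infDist_pos hU').1 (by simpa using hz)
  have pV : ∀ z ∈ V, 0 < dV z := fun z hz =>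
    (hV.isClosed_compl.notMem_iff_infDist_pos hV').1 (by simpa using hz)
  have zU : ∀ z ∉ U, dU z = 0 := fun z hz => Metric.infDist_zero_of_mem hz
  have zV : ∀ z ∉ V, dV z = 0 := fun z hz => Metric.infDist_zero_of_mem hz
  have nU : ∀ z, 0 ≤ dU z := fun z => Metric.infDist_nonneg
  have nV : ∀ z, 0 ≤ dV z := fun z => Metric.infDist_nonneg
  -- products of the bounded function `φ` with functions vanishing off `V` resp. `U` are continuous
  have key : ∀ (W W' : Set ℂ) (d : ℂ → ℝ), IsOpen W → IsOpen W' → ContinuousOn d W →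
      (∀ z ∈ W, z ∉ W' → d z = 0) → ContinuousOn φ (W ∩ W') →
      (∀ z ∈ W ∩ W', φ z = 0 ∨ φ z = 1) →
      ContinuousOn (fun z => if z ∈ W' then d z * φ z else 0) W := by
    intro W W' d hW hW' hd hd0 hφ h01 z hz
    by_cases hz' : z ∈ W'
    · refine ContinuousAt.continuousWithinAt ?_
      refine ContinuousAt.congr (f := fun z => d z * φ z) ?_ ?_
      · exact (hd.continuousAt (hW.mem_nhds hz)).mul
          (hφ.continuousAt ((hW.inter hW').mem_nhds ⟨hz, hz'⟩))
      · filter_upwards [hW'.mem_nhds hz'] with w hw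
        rw [if_pos hw]
    · have hd' : Filter.Tendsto (fun x => ‖d x‖) (𝓝 z) (𝓝 0) := by
        have := (hd.continuousAt (hW.mem_nhds hz)).norm
        simpa [ContinuousAt, hd0 z hz hz'] using this
      refine ContinuousAt.continuousWithinAt ?_
      simp only [ContinuousAt, if_neg hz']
      refine squeeze_zero_norm' ?_ hd'
      filter_upwards [hW.mem_nhds hz] with w hw
      split_ifs with hw'
      · rcases h01 w ⟨hw, hw'⟩ with h | h <;> simp [h]
      · simp
  have sum_ne : ∀ z ∈ U ∪ V, dU z + dV z ≠ 0 := by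
    rintro z (hz | hz)
    · exact (add_pos_of_pos_of_nonneg (pU z hz) (nV z)).ne'
    · exact (add_pos_of_nonneg_of_pos (nU z) (pV z hz)).ne'
  set a : ℂ → ℝ := fun z => if z ∈ V then (dV z / (dU z + dV z)) * φ z else 0 with ha
  set b : ℂ → ℝ := fun z => if z ∈ U then (-(dU z / (dU z + dV z))) * φ z else 0 with hb
  have ca : ContinuousOn a U := key U V _ hU hV
    (cV.continuousOn.div (cU.add cV).continuousOn fun z hz => sum_ne z (Or.inl hz))
    (fun z _ hz => by rw [zV z hz, zero_div]) hφ h01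
  have cb : ContinuousOn b V := key V U _ hV hU
    (cU.continuousOn.div (cU.add cV).continuousOn fun z hz => sum_ne z (Or.inr hz)).neg
    (fun z _ hz => by rw [zU z hz, zero_div, neg_zero]) (by rwa [inter_comm])
    (by rwa [inter_comm])
  have hab : ∀ z ∈ U ∩ V, a z - b z = φ z := by
    rintro z ⟨hz1, hz2⟩
    have := sum_ne z (Or.inl hz1)
    simp only [ha, hb, if_pos hz1, if_pos hz2]
    field_simp
    ring
  set A : ℂ → ℂ := fun z => 2 * Real.pi * Complex.I * a z with hA
  set B : ℂ → ℂ := fun z => 2 * Real.pi * Complex.I * b z with hB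
  have cA : ContinuousOn A U :=
    continuousOn_const.mul (Complex.continuous_ofReal.comp_continuousOn ca)
  have cB : ContinuousOn B V :=
    continuousOn_const.mul (Complex.continuous_ofReal.comp_continuousOn cb)
  have hAB : ∀ z ∈ U ∩ V, A z - B z = 2 * Real.pi * Complex.I * φ z := fun z hz => by
    rw [← hab z hz]; simp only [hA, hB]; push_cast; ring
  have heq : ∀ z ∈ U ∩ V, Complex.exp (A z) = Complex.exp (B z) := fun z hz => by
    have := hAB z hz
    rw [sub_eq_iff_eq_add.1 this, Complex.exp_add]
    rcases h01 z hz with h | h <;> simp [h, Complex.exp_two_pi_mul_I]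
  set h : ℂ → ℂ := fun z => if z ∈ U then Complex.exp (A z) else Complex.exp (B z) with hh
  have hhU : ∀ z ∈ U, Complex.exp (A z) = h z := fun z hz => by simp only [hh, if_pos hz]
  have hhV : ∀ z ∈ V, Complex.exp (B z) = h z := fun z hz => by
    by_cases hzU : z ∈ U
    · simp only [hh, if_pos hzU, heq z ⟨hzU, hz⟩]
    · simp only [hh, if_neg hzU]
  refine ⟨h, A, B, ?_, ?_, cA, cB, hhU, hhV, hAB⟩
  · refine ContinuousOn.union_of_isOpen ?_ ?_ hU hV
    · exact cA.cexp.congr fun z hz => (hhU z hz).symm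
    · exact cB.cexp.congr fun z hz => (hhV z hz).symm
  · intro z
    simp only [hh]
    split_ifs <;> exact Complex.exp_ne_zero _

/-- The indicator function of one side of a partition into two open sets. -/
theorem exists_indicator {W O₁ O₂ : Set ℂ} (h₁ : IsOpen O₁) (h₂ : IsOpen O₂)
    (hW : W ⊆ O₁ ∪ O₂) (hd : ∀ z ∈ W, z ∈ O₁ → z ∉ O₂) :
    ContinuousOn (fun z => if z ∈ O₁ then (1 : ℝ) else 0) W := by
  intro z hz
  rcases hW hz with h | h
  · refine (continuousWithinAt_const (b := (1 : ℝ))).congr_of_eventuallyEq ?_ (if_pos h)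
    filter_upwards [mem_nhdsWithin_of_mem_nhds (h₁.mem_nhds h)] with w hw
    exact if_pos hw
  · refine (continuousWithinAt_const (b := (0 : ℝ))).congr_of_eventuallyEq ?_
      (if_neg fun h' => hd z hz h' h)
    filter_upwards [mem_nhdsWithin_of_mem_nhds (h₂.mem_nhds h), self_mem_nhdsWithin] with w hw hw'
    exact if_neg fun h' => hd w hw' h' hw

theorem isPreconnected_diff_of_tangent {U e : Set ℂ} {a : ℂ} (hU : IsOpen U)
    (hUc : IsPreconnected U) (he : IsCompact e) (hec : IsPreconnected eᶜ) (hae : a ∈ e)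
    (haU : a ∉ U) (heU : e \ {a} ⊆ U) : IsPreconnected (U \ e) := by
  have hunion : U ∪ eᶜ = {a}ᶜ := by
    ext z
    simp only [mem_union, mem_compl_iff, mem_singleton_iff]
    constructor
    · rintro (h | h) rfl
      exacts [haU h, h hae]
    · intro h
      by_cases hz : z ∈ e
      exacts [Or.inl (heU ⟨hz, h⟩), Or.inr hz]
  rintro O₁ O₂ h₁ h₂ hW ⟨x, hxW, hx⟩ ⟨y, hyW, hy⟩
  by_contra hne
  have hd : ∀ z ∈ U \ e, z ∈ O₁ → z ∉ O₂ := fun z hz hz1 hz2 => hne ⟨z, hz, hz1, hz2⟩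
  obtain ⟨h, A, B, hc, h0, hA, hB, hAh, hBh, hAB⟩ := exists_cocycle hU he.isClosed.isOpen_compl
    ⟨a, haU⟩ ⟨a, by simpa using hae⟩ (exists_indicator h₁ h₂ hW hd)
    (fun z _ => by split_ifs <;> simp)
  rw [hunion] at hc
  obtain ⟨g, hg, hgh⟩ := HasLog.compl_singleton he ⟨B, hB, hBh⟩ hc fun z _ => h0 z
  have hUa : U ⊆ {a}ᶜ := hunion ▸ subset_union_left
  have hVa : eᶜ ⊆ {a}ᶜ := hunion ▸ subset_union_right
  obtain ⟨m, hm⟩ := log_unique hUc hA (hg.mono hUa) fun z hz => by rw [hAh z hz, hgh z (hUa hz)]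
  obtain ⟨n, hn⟩ := log_unique hec hB (hg.mono hVa) fun z hz => by rw [hBh z hz, hgh z (hVa hz)]
  have ex := hAB x hxW
  have ey := hAB y hyW
  rw [hm x hxW.1, hn x hxW.2, if_pos hx] at ex
  rw [hm y hyW.1, hn y hyW.2, if_neg fun h' => hd y hyW h' hy] at ey
  refine Complex.two_pi_I_ne_zero ?_
  push_cast at ex ey
  linear_combination ey - ex

theorem not_three_pieces {U e : Set ℂ} {a b : ℂ} (hab : a ≠ b) (hU : IsOpen U)
    (hUc : IsPreconnected U) (he : IsCompact e) (hec : IsPreconnected eᶜ) (hae : a ∈ e)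
    (hbe : b ∈ e) (haU : a ∉ U) (hbU : b ∉ U) (heU : e \ {a, b} ⊆ U) {S₁ S₂ S₃ : Set ℂ}
    (h₁ : IsOpen S₁) (h₂ : IsOpen S₂) (h₃ : IsOpen S₃) (n₁ : S₁.Nonempty) (n₂ : S₂.Nonempty)
    (n₃ : S₃.Nonempty) (d₁₂ : Disjoint S₁ S₂) (d₁₃ : Disjoint S₁ S₃) (d₂₃ : Disjoint S₂ S₃)
    (hS : S₁ ∪ S₂ ∪ S₃ = U \ e) : False := by
  have hunion : U ∪ eᶜ = {a, b}ᶜ := by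
    ext z
    simp only [mem_union, mem_compl_iff, mem_insert_iff, mem_singleton_iff, not_or]
    constructor
    · rintro (h | h)
      · exact ⟨fun h' => haU (h' ▸ h), fun h' => hbU (h' ▸ h)⟩
      · exact ⟨fun h' => h (h' ▸ hae), fun h' => h (h' ▸ hbe)⟩
    · intro h
      by_cases hz : z ∈ e
      exacts [Or.inl (heU ⟨hz, by simpa using h⟩), Or.inr hz]
  have hUa : U ⊆ {a, b}ᶜ := hunion ▸ subset_union_left
  have hVa : eᶜ ⊆ {a, b}ᶜ := hunion ▸ subset_union_right
  -- each piece is, up to constants on both sides, a multiple of one cocycle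
  have key : ∀ S T : Set ℂ, IsOpen S → IsOpen T → S ∪ T = U \ e → Disjoint S T →
      ∃ (k : ℤ) (A B : ℂ → ℂ), ContinuousOn A U ∧ ContinuousOn B eᶜ ∧
        (∀ z ∈ U, Complex.exp (A z) = ((z - a) / (z - b)) ^ k) ∧
        (∀ z ∈ eᶜ, Complex.exp (B z) = ((z - a) / (z - b)) ^ k) ∧
        ∀ z ∈ U \ e, A z - B z = -(2 * Real.pi * Complex.I * (if z ∈ S then 1 else 0)) := by
    intro S T hS hT hST hd
    obtain ⟨h, A, B, hc, h0, hA, hB, hAh, hBh, hAB⟩ := exists_cocycle hU he.isClosed.isOpen_compl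
      ⟨a, haU⟩ ⟨a, by simpa using hae⟩ (exists_indicator hS hT hST.ge
        (fun z _ hz hz' => disjoint_left.1 hd hz hz'))
      (fun z _ => by split_ifs <;> simp)
    rw [hunion] at hc
    obtain ⟨k, g, hg, hgh⟩ := HasLog.compl_pair hab he ⟨B, hB, hBh⟩ hc fun z _ => h0 z
    refine ⟨k, fun z => g z - A z, fun z => g z - B z, (hg.mono hUa).sub hA, (hg.mono hVa).sub hB,
      fun z hz => ?_, fun z hz => ?_, fun z hz => ?_⟩
    · rw [Complex.exp_sub, hgh z (hUa hz), hAh z hz, mul_div_cancel_left₀ _ (h0 z)]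
    · rw [Complex.exp_sub, hgh z (hVa hz), hBh z hz, mul_div_cancel_left₀ _ (h0 z)]
    · have := hAB z ⟨hz.1, hz.2⟩
      split_ifs at this ⊢ <;> push_cast at this <;> linear_combination -this
  have sub : ∀ {S : Set ℂ}, S ⊆ S₁ ∪ S₂ ∪ S₃ → S ⊆ U \ e := fun h => h.trans hS.subset
  have s₁ : S₁ ⊆ U \ e := sub fun z hz => Or.inl (Or.inl hz)
  have s₂ : S₂ ⊆ U \ e := sub fun z hz => Or.inl (Or.inr hz)
  have s₃ : S₃ ⊆ U \ e := sub fun z hz => Or.inr hz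
  obtain ⟨x₁, hx₁⟩ := n₁
  obtain ⟨x₂, hx₂⟩ := n₂
  obtain ⟨x₃, hx₃⟩ := n₃
  obtain ⟨k₁, A₁, B₁, cA₁, cB₁, eA₁, eB₁, hAB₁⟩ := key S₁ (S₂ ∪ S₃) h₁ (h₂.union h₃)
    (by rw [← hS, union_assoc]) (disjoint_union_right.2 ⟨d₁₂, d₁₃⟩)
  obtain ⟨k₂, A₂, B₂, cA₂, cB₂, eA₂, eB₂, hAB₂⟩ := key S₂ (S₁ ∪ S₃) h₂ (h₁.union h₃)
    (by rw [← hS, ← union_assoc, union_comm S₂]) (disjoint_union_right.2 ⟨d₁₂.symm, d₂₃⟩)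
  have unit : ∀ (α β w : ℂ), Complex.exp α = w ^ k₁ → Complex.exp β = w ^ k₂ →
      Complex.exp (k₂ * α - k₁ * β) = Complex.exp 0 := by
    intro α β w h h'
    rw [Complex.exp_sub, Complex.exp_int_mul, Complex.exp_int_mul, Complex.exp_zero,
      div_eq_one_iff_eq (zpow_ne_zero _ (Complex.exp_ne_zero _)), h, h', ← zpow_mul, ← zpow_mul,
      mul_comm]
  obtain ⟨m, hm⟩ := log_unique (g₂ := fun _ => 0) hUc
    ((continuousOn_const.mul cA₁).sub (continuousOn_const.mul cA₂)) continuousOn_const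
    fun z hz => unit _ _ _ (eA₁ z hz) (eA₂ z hz)
  obtain ⟨n, hn⟩ := log_unique (g₂ := fun _ => 0) hec
    ((continuousOn_const.mul cB₁).sub (continuousOn_const.mul cB₂)) continuousOn_const
    fun z hz => unit _ _ _ (eB₁ z hz) (eB₂ z hz)
  have rel : ∀ z ∈ U \ e, (k₁ : ℂ) * (if z ∈ S₂ then 1 else 0) - k₂ * (if z ∈ S₁ then 1 else 0)
      = m - n := by
    intro z hz
    refine mul_left_cancel₀ Complex.two_pi_I_ne_zero ?_
    have hm := hm z hz.1
    have hn := hn z hz.2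
    simp only [Pi.sub_apply, Pi.mul_apply] at hm hn
    linear_combination hm - hn - k₂ * hAB₁ z hz + k₁ * hAB₂ z hz
  have r₁ := rel x₁ (s₁ hx₁)
  have r₂ := rel x₂ (s₂ hx₂)
  have r₃ := rel x₃ (s₃ hx₃)
  rw [if_neg (disjoint_left.1 d₁₂ hx₁), if_pos hx₁] at r₁
  rw [if_pos hx₂, if_neg (disjoint_right.1 d₁₂ hx₂)] at r₂
  rw [if_neg (disjoint_right.1 d₂₃ hx₃), if_neg (disjoint_right.1 d₁₃ hx₃)] at r₃
  have hk₁ : k₁ = 0 := by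
    have : (k₁ : ℂ) = 0 := by linear_combination r₂ - r₃
    exact_mod_cast this
  obtain ⟨m', hm'⟩ := log_unique (g₂ := fun _ => 0) hUc cA₁ continuousOn_const
    fun z hz => by rw [eA₁ z hz, hk₁, zpow_zero, Complex.exp_zero]
  obtain ⟨n', hn'⟩ := log_unique (g₂ := fun _ => 0) hec cB₁ continuousOn_const
    fun z hz => by rw [eB₁ z hz, hk₁, zpow_zero, Complex.exp_zero]
  have q₁ := hAB₁ x₁ (s₁ hx₁)
  have q₂ := hAB₁ x₂ (s₂ hx₂)
  rw [if_pos hx₁, hm' _ (s₁ hx₁).1, hn' _ (s₁ hx₁).2] at q₁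
  rw [if_neg (disjoint_right.1 d₁₂ hx₂), hm' _ (s₂ hx₂).1, hn' _ (s₂ hx₂).2] at q₂
  exact Complex.two_pi_I_ne_zero (by linear_combination q₁ - q₂)

/-- `e` is a simple arc with endpoints `a` and `b`. -/
def IsArc {X : Type*} [TopologicalSpace X] (e : Set X) (a b : X) : Prop :=
  ∃ γ : ℝ → X, ContinuousOn γ (Icc 0 1) ∧ InjOn γ (Icc 0 1) ∧ γ 0 = a ∧ γ 1 = b ∧
    γ '' Icc 0 1 = e

theorem frontier_connectedComponentIn_subset {X : Type*} [TopologicalSpace X]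
    [LocallyConnectedSpace X] {D : Set X} (hD : IsClosed D) (x : X) :
    frontier (connectedComponentIn Dᶜ x) ⊆ D := by
  intro z hz
  by_contra hzD
  have hU := hD.isOpen_compl.connectedComponentIn (x := x)
  rw [hU.frontier_eq] at hz
  have hz' := connectedComponentIn_mem_nhds (hD.isOpen_compl.mem_nhds hzD)
  obtain ⟨w, hw, hw'⟩ := mem_closure_iff_nhds.1 hz.1 _ hz'
  have h := connectedComponentIn_eq hw
  rw [← connectedComponentIn_eq hw'] at h
  exact hz.2 (h ▸ mem_connectedComponentIn hzD)

theorem hasLog_of_joinedIn {K : Set ℂ} {a b : ℂ} (h : JoinedIn K a b) :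
    HasLog (fun z => (z - a) / (z - b)) Kᶜ := by
  obtain ⟨γ, hγ⟩ := h.symm
  have hne : ∀ (t : unitInterval) (z : (Kᶜ : Set ℂ)), (z : ℂ) - γ t ≠ 0 := fun t z =>
    sub_ne_zero.2 fun h => z.2 (h ▸ hγ t)
  have hc : Continuous fun q : unitInterval × (Kᶜ : Set ℂ) =>
      ((q.2 : ℂ) - γ q.1) / ((q.2 : ℂ) - γ 0) :=
    ((continuous_subtype_val.comp continuous_snd).sub (γ.continuous.comp continuous_fst)).div
      ((continuous_subtype_val.comp continuous_snd).sub continuous_const) fun q => hne 0 q.2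
  let H : C(unitInterval × (Kᶜ : Set ℂ), {z : ℂ // z ≠ 0}) :=
    ⟨fun q => ⟨_, div_ne_zero (hne q.1 q.2) (hne 0 q.2)⟩, hc.subtype_mk _⟩
  have H0 : ∀ z, H (0, z) = ⟨Complex.exp ((ContinuousMap.const (Kᶜ : Set ℂ) (0 : ℂ)) z),
      Complex.exp_ne_zero _⟩ := fun z => Subtype.ext (by
    simp only [H, ContinuousMap.coe_mk, ContinuousMap.const_apply, Complex.exp_zero]
    exact div_self (hne 0 z))
  let L := Complex.isCoveringMap_exp.liftHomotopy H (ContinuousMap.const _ 0) H0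
  have hL := Complex.isCoveringMap_exp.liftHomotopy_lifts H (ContinuousMap.const _ 0) H0
  refine ⟨fun z => if hz : z ∈ Kᶜ then L (1, ⟨z, hz⟩) else 0, ?_, fun z hz => ?_⟩
  · rw [continuousOn_iff_continuous_domRestrict]
    refine (L.continuous.comp (Continuous.prodMk_right 1)).congr fun z => ?_
    simp only [Function.comp_apply, domRestrict_apply, dif_pos z.2]
  · have h1 : Complex.exp (L (1, ⟨z, hz⟩)) = (z - γ 1) / (z - γ 0) :=
      congrArg Subtype.val (congrFun hL (1, ⟨z, hz⟩))
    simp only [dif_pos hz, h1, γ.source, γ.target]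

theorem isPreconnected_norm_gt {R : ℝ} (hR : 0 < R) : IsPreconnected {z : ℂ | R < ‖z‖} := by
  have h : {z : ℂ | R < ‖z‖} = Complex.exp '' {w | Real.log R < w.re} := by
    ext z
    constructor
    · intro hz
      have hz0 : z ≠ 0 := norm_pos_iff.1 (hR.trans hz)
      refine ⟨Complex.log z, ?_, Complex.exp_log hz0⟩
      rw [mem_ofPred_eq, Complex.log_re]
      exact Real.log_lt_log hR hz
    · rintro ⟨w, hw, rfl⟩
      rw [mem_ofPred_eq, Complex.norm_exp]
      exact (Real.log_lt_iff_lt_exp hR).1 hw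
  rw [h]
  exact (convex_halfSpace_re_gt _).isPreconnected.image _ Complex.continuous_exp.continuousOn

theorem IsArc.exists_retraction {e : Set ℂ} {a b : ℂ} (h : IsArc e a b) :
    ∃ r : ℂ → ℂ, Continuous r ∧ (∀ z, r z ∈ e) ∧ ∀ z ∈ e, r z = z := by
  obtain ⟨γ, hc, hi, -, -, rfl⟩ := h
  have hemb : IsClosedEmbedding ((Icc (0 : ℝ) 1).domRestrict γ) :=
    (continuousOn_iff_continuous_domRestrict.1 hc).isClosedEmbedding (injOn_iff_injective.1 hi)
  obtain ⟨g, hg, hgγ⟩ := ContinuousMap.exists_extension_forall_mem (t := Icc (0 : ℝ) 1) hemb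
    (⟨Subtype.val, continuous_subtype_val⟩ : C(Icc (0 : ℝ) 1, ℝ)) (fun x => x.2)
  refine ⟨fun z => γ (g z), hc.comp_continuous g.continuous hg, fun z => ⟨_, hg z, rfl⟩, ?_⟩
  rintro _ ⟨t, ht, rfl⟩
  have := congrArg (fun f : C(Icc (0 : ℝ) 1, ℝ) => f ⟨t, ht⟩) hgγ
  exact congrArg γ this

theorem IsArc.isCompact {X : Type*} [TopologicalSpace X] {e : Set X} {a b : X}
    (h : IsArc e a b) : IsCompact e := by
  obtain ⟨γ, hc, -, -, -, rfl⟩ := h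
  exact isCompact_Icc.image_of_continuousOn hc

theorem IsArc.isPreconnected_compl {e : Set ℂ} {a b : ℂ} (h : IsArc e a b) :
    IsPreconnected eᶜ := by
  have he := h.isCompact
  obtain ⟨r, hr, hre, hrid⟩ := h.exists_retraction
  obtain ⟨R, hR0, hR⟩ := he.isBounded.subset_ball_lt 0 0
  have hout : {z : ℂ | R < ‖z‖} ⊆ eᶜ := fun z hz hze => by
    have := hR hze
    rw [mem_ball_zero_iff] at this
    exact lt_asymm hz this
  have key : ∀ p ∈ eᶜ, ∃ z ∈ connectedComponentIn eᶜ p, R < ‖z‖ := by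
    intro p hp
    by_contra! hb
    set U := connectedComponentIn eᶜ p with hU
    have hh : Continuous fun z => if z ∈ U then r z - p else z - p := by
      refine Continuous.if (fun z hz => ?_) (hr.sub continuous_const)
        (continuous_id.sub continuous_const)
      rw [hrid z (frontier_connectedComponentIn_subset he.isClosed p hz)]
    obtain ⟨g, hg, hge⟩ := hasLog_univ hh fun z => by
      split_ifs with hz
      · exact sub_ne_zero.2 fun h => hp (h ▸ hre z)
      · exact sub_ne_zero.2 fun h => hz (h ▸ mem_connectedComponentIn hp)
    refine not_hasLog_sphere p (r := R + ‖p‖ + 1) (by positivity)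
      ⟨g, hg.mono (subset_univ _), fun z hz => ?_⟩
    refine (hge z (mem_univ z)).trans (if_neg fun hzU => ?_)
    have h1 := hb z hzU
    rw [mem_sphere_iff_norm] at hz
    linarith [norm_sub_le z p]
  refine isPreconnected_of_forall (((R + 1 : ℝ) : ℂ)) fun p hp => ?_
  obtain ⟨z, hz, hzR⟩ := key p hp
  refine ⟨connectedComponentIn eᶜ p ∪ {z | R < ‖z‖},
    union_subset (connectedComponentIn_subset _ _) hout, Or.inr ?_,
    Or.inl (mem_connectedComponentIn hp), isPreconnected_connectedComponentIn.union z hz hzR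
      (isPreconnected_norm_gt hR0)⟩
  rw [mem_ofPred_eq, Complex.norm_real, Real.norm_of_nonneg (by linarith)]
  linarith

theorem not_hasLog_compl_pair {a b : ℂ} (hab : a ≠ b) :
    ¬ HasLog (fun z => (z - a) / (z - b)) {a, b}ᶜ := by
  rintro ⟨g, hg, hge⟩
  have hba : a - b ≠ 0 := sub_ne_zero.2 hab
  have hr : 0 < ‖a - b‖ := norm_pos_iff.2 hba
  have hsub : Metric.sphere a (‖a - b‖ / 2) ⊆ {a, b}ᶜ := by
    rintro z hz (rfl | rfl)
    · rw [mem_sphere_iff_norm, sub_self, norm_zero] at hz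
      linarith
    · rw [mem_sphere_iff_norm, norm_sub_rev] at hz
      linarith
  have hs : ∀ z ∈ Metric.sphere a (‖a - b‖ / 2), (z - b) / (a - b) ∈ Complex.slitPlane := by
    intro z hz
    rw [mem_sphere_iff_norm] at hz
    have : (z - b) / (a - b) = 1 + (z - a) / (a - b) := by
      field_simp
      ring
    rw [this]
    refine Complex.mem_slitPlane_of_norm_lt_one ?_
    rw [norm_div, hz]
    rw [div_div, mul_comm, ← div_div, div_self hr.ne']
    norm_num
  refine not_hasLog_sphere a (half_pos hr)
    ⟨fun z => g z + (Complex.log ((z - b) / (a - b)) + Complex.log (a - b)),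
      (hg.mono hsub).add (ContinuousOn.add ?_ continuousOn_const), fun z hz => ?_⟩
  · exact ContinuousOn.clog
      ((continuousOn_id.sub continuousOn_const).div_const _) hs
  · have hzb : z - b ≠ 0 := sub_ne_zero.2 fun h => hsub hz (Or.inr h)
    rw [Complex.exp_add, Complex.exp_add, Complex.exp_log hba,
      Complex.exp_log (div_ne_zero hzb hba), hge z (hsub hz)]
    field_simp

theorem not_isPreconnected_diff {U e : Set ℂ} {a b : ℂ} (hab : a ≠ b) (hU : IsOpen U)
    (he : IsArc e a b) (heU : e \ {a, b} ⊆ U)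
    (hj : JoinedIn Uᶜ a b) : ¬ IsPreconnected (U \ e) := by
  intro hpre
  have hae : a ∈ e := by
    obtain ⟨γ, -, -, h0, -, rfl⟩ := he
    exact ⟨0, by simp, h0⟩
  have hbe : b ∈ e := by
    obtain ⟨γ, -, -, -, h1, rfl⟩ := he
    exact ⟨1, by simp, h1⟩
  have hje : JoinedIn e a b := by
    obtain ⟨γ, hc, -, h0, h1, rfl⟩ := he
    exact JoinedIn.ofLine hc h0 h1 subset_rfl
  obtain ⟨g₁, hg₁, hge₁⟩ := hasLog_of_joinedIn hj
  rw [compl_compl] at hg₁ hge₁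
  obtain ⟨g₂, hg₂, hge₂⟩ := hasLog_of_joinedIn hje
  obtain ⟨n, hn⟩ := log_unique hpre (hg₁.mono sdiff_subset)
    (hg₂.mono fun z hz => hz.2) fun z hz => by rw [hge₁ z hz.1, hge₂ z hz.2]
  refine not_hasLog_compl_pair hab
    ⟨fun z => if z ∈ U then g₁ z else g₂ z + n * (2 * Real.pi * Complex.I), ?_, ?_⟩
  · have hc : ContinuousOn (fun z => if z ∈ U then g₁ z else g₂ z + n * (2 * Real.pi * Complex.I))
        (U ∪ eᶜ) := by
      refine ContinuousOn.union_of_isOpen (hg₁.congr fun z hz => if_pos hz)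
        ((hg₂.add (continuousOn_const (c := n * (2 * Real.pi * Complex.I)))).congr fun z hz => ?_) hU he.isCompact.isClosed.isOpen_compl
      by_cases hzU : z ∈ U
      · simp only [if_pos hzU, hn z ⟨hzU, hz⟩, Pi.add_apply]
      · simp only [if_neg hzU, Pi.add_apply]
    refine hc.mono fun z hz => ?_
    by_cases hze : z ∈ e
    exacts [Or.inl (heU ⟨hze, hz⟩), Or.inr hze]
  · intro z hz
    by_cases hzU : z ∈ U
    · simp only [if_pos hzU, hge₁ z hzU]
    · have hze : z ∈ eᶜ := fun hze => hzU (heU ⟨hze, hz⟩)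
      simp only [if_neg hzU]
      rw [Complex.exp_add, Complex.exp_int_mul_two_pi_mul_I, mul_one, hge₂ z hze]

section ArcTopology

variable {X Y : Type*} [TopologicalSpace X] [TopologicalSpace Y]

theorem IsArc.left_mem {e : Set X} {a b : X} (h : IsArc e a b) : a ∈ e := by
  obtain ⟨γ, -, -, h0, -, rfl⟩ := h
  exact ⟨0, by simp, h0⟩

theorem IsArc.right_mem {e : Set X} {a b : X} (h : IsArc e a b) : b ∈ e := by
  obtain ⟨γ, -, -, -, h1, rfl⟩ := h
  exact ⟨1, by simp, h1⟩

theorem IsArc.ne {e : Set X} {a b : X} (h : IsArc e a b) : a ≠ b := by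
  obtain ⟨γ, -, hi, rfl, rfl, -⟩ := h
  exact fun h => zero_ne_one (hi (by simp) (by simp) h)

theorem IsArc.joinedIn {e : Set X} {a b : X} (h : IsArc e a b) : JoinedIn e a b := by
  obtain ⟨γ, hc, -, h0, h1, rfl⟩ := h
  exact JoinedIn.ofLine hc h0 h1 subset_rfl

theorem IsArc.image {e : Set X} {a b : X} (h : IsArc e a b) (φ : X ≃ₜ Y) :
    IsArc (φ '' e) (φ a) (φ b) := by
  obtain ⟨γ, hc, hi, rfl, rfl, rfl⟩ := h
  exact ⟨φ ∘ γ, φ.continuous.comp_continuousOn hc, φ.injective.comp_injOn hi, rfl, rfl,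
    image_comp _ _ _⟩

/-- The homeomorphism between the real plane and the complex numbers. -/
def toComplex : ℝ × ℝ ≃ₜ ℂ := Complex.equivRealProdCLM.symm.toHomeomorph

/-- Removing an arc which leaves the open connected set `U` at a single point of the arc does not
disconnect `U`. -/
theorem IsArc.isPreconnected_diff {U e : Set (ℝ × ℝ)} {a b c : ℝ × ℝ} (he : IsArc e b c)
    (hU : IsOpen U) (hUc : IsPreconnected U) (hae : a ∈ e) (haU : a ∉ U) (heU : e \ {a} ⊆ U) :
    IsPreconnected (U \ e) := by
  have he' := he.image toComplex
  rw [← toComplex.isPreconnected_image, image_sdiff toComplex.injective]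
  refine isPreconnected_diff_of_tangent (a := toComplex a) (toComplex.isOpen_image.2 hU)
    (toComplex.isPreconnected_image.2 hUc) he'.isCompact he'.isPreconnected_compl
    (mem_image_of_mem _ hae) (by simpa using haU) ?_
  rw [← image_singleton, ← image_sdiff toComplex.injective]
  exact image_mono heU

/-- Removing a cross cut from an open connected set leaves at most two pieces. -/
theorem IsArc.not_three_pieces {U e : Set (ℝ × ℝ)} {a b : ℝ × ℝ} (he : IsArc e a b)
    (hU : IsOpen U) (hUc : IsPreconnected U) (haU : a ∉ U) (hbU : b ∉ U)
    (heU : e \ {a, b} ⊆ U) {S₁ S₂ S₃ : Set (ℝ × ℝ)}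
    (h₁ : IsOpen S₁) (h₂ : IsOpen S₂) (h₃ : IsOpen S₃) (n₁ : S₁.Nonempty) (n₂ : S₂.Nonempty)
    (n₃ : S₃.Nonempty) (d₁₂ : Disjoint S₁ S₂) (d₁₃ : Disjoint S₁ S₃) (d₂₃ : Disjoint S₂ S₃)
    (hS : S₁ ∪ S₂ ∪ S₃ = U \ e) : False := by
  have he' := he.image toComplex
  have inj := toComplex.injective
  refine PlaneTopology.not_three_pieces (he'.ne) (toComplex.isOpen_image.2 hU)
    (toComplex.isPreconnected_image.2 hUc) he'.isCompact he'.isPreconnected_compl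
    he'.left_mem he'.right_mem (by simpa using haU) (by simpa using hbU) ?_
    (toComplex.isOpen_image.2 h₁) (toComplex.isOpen_image.2 h₂) (toComplex.isOpen_image.2 h₃)
    (n₁.image _) (n₂.image _) (n₃.image _) ((disjoint_image_iff inj).2 d₁₂)
    ((disjoint_image_iff inj).2 d₁₃) ((disjoint_image_iff inj).2 d₂₃)
    (by rw [← image_union, ← image_union, hS, image_sdiff inj])
  rw [← image_pair, ← image_sdiff inj]
  exact image_mono heU

/-- Removing from an open set `U` a cross cut whose endpoints are joined off `U` disconnects
`U`. -/
theorem IsArc.not_isPreconnected_diff {U e : Set (ℝ × ℝ)} {a b : ℝ × ℝ} (he : IsArc e a b)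
    (hU : IsOpen U) (heU : e \ {a, b} ⊆ U) (hj : JoinedIn Uᶜ a b) :
    ¬ IsPreconnected (U \ e) := by
  have he' := he.image toComplex
  have inj := toComplex.injective
  rw [← toComplex.isPreconnected_image, image_sdiff inj]
  refine PlaneTopology.not_isPreconnected_diff he'.ne (toComplex.isOpen_image.2 hU) he' ?_ ?_
  · rw [← image_pair, ← image_sdiff inj]
    exact image_mono heU
  · obtain ⟨γ, hγ⟩ := hj
    refine ⟨γ.map toComplex.continuous, fun t => ?_⟩
    rw [← toComplex.image_compl]
    exact mem_image_of_mem _ (hγ t)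

end ArcTopology

theorem image_Icc_sdiff_ends {X : Type*} {γ : ℝ → X} (hi : InjOn γ (Icc 0 1)) :
    γ '' Icc 0 1 \ {γ 0, γ 1} = γ '' Ioo 0 1 := by
  rw [← image_pair, ← hi.image_sdiff_subset (by rintro _ (rfl | rfl) <;> simp)]
  rw [Icc_sdiff_both]

section Arc

variable {X : Type*} [TopologicalSpace X]

theorem IsArc.symm {e : Set X} {a b : X} (h : IsArc e a b) : IsArc e b a := by
  obtain ⟨γ, hc, hi, h0, h1, rfl⟩ := h
  have hm : MapsTo (fun t : ℝ => 1 - t) (Icc 0 1) (Icc 0 1) := fun t ht =>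
    ⟨by linarith [ht.2], by linarith [ht.1]⟩
  refine ⟨fun t => γ (1 - t), hc.comp (by fun_prop) hm, fun s hs t ht hst => ?_, by simpa,
    by simpa, ?_⟩
  · have := hi (hm hs) (hm ht) hst
    linarith
  · refine Subset.antisymm (image_subset_iff.2 fun t ht => ⟨_, hm ht, rfl⟩) ?_
    rintro _ ⟨t, ht, rfl⟩
    exact ⟨1 - t, hm ht, by simp⟩

theorem isArc_image_Icc {γ : ℝ → X} {s t : ℝ} (hst : s < t) (hc : ContinuousOn γ (Icc s t))
    (hi : InjOn γ (Icc s t)) : IsArc (γ '' Icc s t) (γ s) (γ t) := by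
  have hts : 0 < t - s := sub_pos.2 hst
  have hm : MapsTo (fun u : ℝ => s + u * (t - s)) (Icc 0 1) (Icc s t) := fun u hu =>
    ⟨by nlinarith [hu.1], by nlinarith [hu.2]⟩
  refine ⟨fun u => γ (s + u * (t - s)), hc.comp (by fun_prop) hm, fun u hu v hv huv => ?_,
    by simp, by simp, ?_⟩
  · have := hi (hm hu) (hm hv) huv
    exact mul_right_cancel₀ hts.ne' (add_left_cancel this)
  · refine Subset.antisymm (image_subset_iff.2 fun u hu => ⟨_, hm hu, rfl⟩) ?_
    rintro _ ⟨u, hu, rfl⟩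
    refine ⟨(u - s) / (t - s), ⟨div_nonneg (by linarith [hu.1]) hts.le,
      (div_le_one hts).2 (by linarith [hu.2])⟩, ?_⟩
    simp only
    rw [div_mul_cancel₀ _ hts.ne', add_sub_cancel]

theorem IsArc.isPreconnected_interior {e : Set X} {a b : X} (h : IsArc e a b) :
    IsPreconnected (e \ {a, b}) := by
  obtain ⟨γ, hc, hi, rfl, rfl, rfl⟩ := h
  rw [image_Icc_sdiff_ends hi]
  exact isPreconnected_Ioo.image _ (hc.mono Ioo_subset_Icc_self)

theorem IsArc.interior_nonempty {e : Set X} {a b : X} (h : IsArc e a b) :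
    (e \ {a, b}).Nonempty := by
  obtain ⟨γ, hc, hi, rfl, rfl, rfl⟩ := h
  rw [image_Icc_sdiff_ends hi]
  exact (nonempty_Ioo.2 zero_lt_one).image _

theorem IsArc.subset_closure_interior {e : Set X} {a b : X} (h : IsArc e a b) :
    e ⊆ closure (e \ {a, b}) := by
  obtain ⟨γ, hc, hi, rfl, rfl, rfl⟩ := h
  rw [image_Icc_sdiff_ends hi]
  rw [← closure_Ioo (zero_ne_one' ℝ)] at hc ⊢
  exact hc.image_closure

theorem IsArc.isPreconnected_sdiff_right {e : Set X} {a b : X} (h : IsArc e a b) :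
    IsPreconnected (e \ {b}) := by
  refine h.isPreconnected_interior.subset_closure ?_ ?_
  · exact sdiff_subset_sdiff_right (by simp)
  · exact sdiff_subset.trans h.subset_closure_interior

end Arc

section Face

variable {D f g : Set (ℝ × ℝ)}

theorem _root_.IsFaceOf.isPreconnected (hf : IsFaceOf D f) : IsPreconnected f := by
  obtain ⟨z, -, rfl⟩ := hf
  exact isPreconnected_connectedComponentIn

theorem _root_.IsFaceOf.nonempty (hf : IsFaceOf D f) : f.Nonempty := by
  obtain ⟨z, hz, rfl⟩ := hf
  exact ⟨z, mem_connectedComponentIn hz⟩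

theorem _root_.IsFaceOf.subset_compl (hf : IsFaceOf D f) : f ⊆ Dᶜ := by
  obtain ⟨z, -, rfl⟩ := hf
  exact connectedComponentIn_subset _ _

theorem _root_.IsFaceOf.isOpen (hf : IsFaceOf D f) (hD : IsClosed D) : IsOpen f := by
  obtain ⟨z, -, rfl⟩ := hf
  exact hD.isOpen_compl.connectedComponentIn

theorem _root_.IsFaceOf.subset_of_isPreconnected (hf : IsFaceOf D f) {t : Set (ℝ × ℝ)}
    (ht : IsPreconnected t) (htD : t ⊆ Dᶜ) (h : (t ∩ f).Nonempty) : t ⊆ f := by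
  obtain ⟨z, -, rfl⟩ := hf
  obtain ⟨w, hwt, hw⟩ := h
  rw [connectedComponentIn_eq hw]
  exact ht.subset_connectedComponentIn hwt htD

theorem _root_.IsFaceOf.eq_of_inter (hf : IsFaceOf D f) (hg : IsFaceOf D g)
    (h : (f ∩ g).Nonempty) : f = g :=
  (hg.subset_of_isPreconnected hf.isPreconnected hf.subset_compl h).antisymm
    (hf.subset_of_isPreconnected hg.isPreconnected hg.subset_compl (inter_comm f g ▸ h))

theorem _root_.IsFaceOf.disjoint (hf : IsFaceOf D f) (hg : IsFaceOf D g) (h : f ≠ g) :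
    Disjoint f g := by
  rw [disjoint_iff_inter_eq_empty, ← not_nonempty_iff_eq_empty]
  exact fun h' => h (hf.eq_of_inter hg h')

theorem _root_.IsFaceOf.closure_subset (hf : IsFaceOf D f) (hD : IsClosed D) :
    closure f ⊆ f ∪ D := by
  rw [closure_eq_self_union_frontier]
  obtain ⟨z, -, rfl⟩ := hf
  exact union_subset_union_right _ (frontier_connectedComponentIn_subset hD z)

theorem isFaceOf_of_closure_subset (ho : IsOpen f) (hp : IsPreconnected f) (hn : f.Nonempty)
    (hfD : f ⊆ Dᶜ) (hc : closure f ⊆ f ∪ D) : IsFaceOf D f := by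
  obtain ⟨z, hz⟩ := hn
  refine ⟨z, hfD hz, (hp.subset_connectedComponentIn hz hfD).antisymm ?_⟩
  refine isPreconnected_connectedComponentIn.subset_of_closure_inter_subset ho
    ⟨z, mem_connectedComponentIn (hfD hz), hz⟩ ?_
  rintro w ⟨hw, hw'⟩
  exact (hc hw).resolve_right (connectedComponentIn_subset _ _ hw')

theorem exists_isFaceOf {z : ℝ × ℝ} (hz : z ∉ D) : ∃ g, IsFaceOf D g ∧ z ∈ g :=
  ⟨_, ⟨z, hz, rfl⟩, mem_connectedComponentIn hz⟩

theorem exists_isFaceOf_of_isPreconnected {t : Set (ℝ × ℝ)} (ht : IsPreconnected t)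
    (hn : t.Nonempty) (htD : t ⊆ Dᶜ) : ∃ g, IsFaceOf D g ∧ t ⊆ g := by
  obtain ⟨z, hz⟩ := hn
  obtain ⟨g, hg, hzg⟩ := exists_isFaceOf (htD hz)
  exact ⟨g, hg, hg.subset_of_isPreconnected ht htD ⟨z, hz, hzg⟩⟩

/-- Every point of the plane has arbitrarily small open neighbourhoods which stay connected after
deleting the point. -/
theorem exists_isOpen_isPreconnected_punctured {p : ℝ × ℝ} {O : Set (ℝ × ℝ)} (hO : O ∈ 𝓝 p) :
    ∃ B, IsOpen B ∧ p ∈ B ∧ B ⊆ O ∧ IsPreconnected (B \ {p}) := by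
  have hO' : toComplex.symm ⁻¹' O ∈ 𝓝 (toComplex p) := by
    refine toComplex.symm.continuous.continuousAt.preimage_mem_nhds ?_
    simpa using hO
  obtain ⟨r, hr, hrO⟩ := Metric.mem_nhds_iff.1 hO'
  refine ⟨toComplex ⁻¹' Metric.ball (toComplex p) r,
    Metric.isOpen_ball.preimage toComplex.continuous, Metric.mem_ball_self hr, fun z hz => ?_, ?_⟩
  · simpa using hrO hz
  · have h : toComplex '' (toComplex ⁻¹' Metric.ball (toComplex p) r \ {p}) =
        (fun w => toComplex p + Complex.exp w) '' {w | w.re < Real.log r} := by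
      rw [image_sdiff toComplex.injective, image_preimage_eq _ toComplex.surjective,
        image_singleton]
      ext z
      constructor
      · rintro ⟨hz, hzp⟩
        have hz0 : z - toComplex p ≠ 0 := sub_ne_zero.2 hzp
        refine ⟨Complex.log (z - toComplex p), ?_, ?_⟩
        · rw [mem_ofPred_eq, Complex.log_re]
          exact Real.log_lt_log (norm_pos_iff.2 hz0) (mem_ball_iff_norm.1 hz)
        · simp only [Complex.exp_log hz0, add_sub_cancel]
      · rintro ⟨w, hw, rfl⟩
        refine ⟨?_, by simp⟩
        rw [mem_ball_iff_norm, add_sub_cancel_left, Complex.norm_exp]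
        exact (Real.lt_log_iff_exp_lt hr).1 hw
    rw [← toComplex.isPreconnected_image, h]
    exact (convex_halfSpace_re_lt _).isPreconnected.image _ (by fun_prop)

end Face

/-- A finite system of arcs in the plane with endpoints in a finite set of points, any two of which
meet only in this set. -/
structure ArcSystem (ι : Type*) where
  pts : Set (ℝ × ℝ)
  arc : ι → Set (ℝ × ℝ)
  src : ι → ℝ × ℝ
  tgt : ι → ℝ × ℝ
  finite_pts : pts.Finite
  isArc : ∀ i, IsArc (arc i) (src i) (tgt i)
  arc_inter_pts : ∀ i, arc i ∩ pts = {src i, tgt i}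
  arc_inter : ∀ i j, i ≠ j → arc i ∩ arc j ⊆ pts

namespace ArcSystem

variable {ι : Type*} (A : ArcSystem ι) {S : Set ι} {f g : Set (ℝ × ℝ)} {i : ι}

/-- The point set drawn by the arcs with index in `S`, together with all vertices. -/
def carrier (S : Set ι) : Set (ℝ × ℝ) := A.pts ∪ ⋃ i ∈ S, A.arc i

theorem pts_subset_carrier : A.pts ⊆ A.carrier S := subset_union_left

theorem arc_subset_carrier (hi : i ∈ S) : A.arc i ⊆ A.carrier S :=
  (subset_biUnion_of_mem (u := A.arc) hi).trans subset_union_right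

theorem src_mem (i : ι) : A.src i ∈ A.pts :=
  ((A.arc_inter_pts i).symm.subset (mem_insert _ _)).2

theorem tgt_mem (i : ι) : A.tgt i ∈ A.pts :=
  ((A.arc_inter_pts i).symm.subset (mem_insert_of_mem _ rfl)).2

theorem interior_eq (i : ι) : A.arc i \ {A.src i, A.tgt i} = A.arc i \ A.pts := by
  rw [← A.arc_inter_pts i, sdiff_self_inter]

theorem interior_subset_compl (i : ι) (hi : i ∉ S) : A.arc i \ A.pts ⊆ (A.carrier S)ᶜ := by
  rintro z ⟨hz, hzp⟩ (h | h)
  · exact hzp h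
  · obtain ⟨j, hj, hzj⟩ := mem_iUnion₂.1 h
    exact hzp (A.arc_inter i j (fun h => hi (h ▸ hj)) ⟨hz, hzj⟩)

theorem carrier_eq_insert (hi : i ∈ S) :
    A.carrier S = A.carrier (S \ {i}) ∪ A.arc i := by
  have : S = S \ {i} ∪ {i} := by simp [hi]
  conv_lhs => rw [this]
  rw [carrier, biUnion_union, biUnion_singleton, carrier, union_assoc]

theorem isPreconnected_interior (i : ι) : IsPreconnected (A.arc i \ A.pts) :=
  A.interior_eq i ▸ (A.isArc i).isPreconnected_interior

theorem interior_nonempty (i : ι) : (A.arc i \ A.pts).Nonempty :=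
  A.interior_eq i ▸ (A.isArc i).interior_nonempty

theorem subset_closure_interior (i : ι) : A.arc i ⊆ closure (A.arc i \ A.pts) :=
  A.interior_eq i ▸ (A.isArc i).subset_closure_interior

/-- The face of the drawing without the arc `i` that contains the interior of this arc. -/
def region (S : Set ι) (i : ι) : Set (ℝ × ℝ) :=
  connectedComponentIn (A.carrier (S \ {i}))ᶜ (A.interior_nonempty i).some

theorem isFaceOf_region (S : Set ι) (i : ι) : IsFaceOf (A.carrier (S \ {i})) (A.region S i) :=
  ⟨_, A.interior_subset_compl i (by simp) (A.interior_nonempty i).some_mem, rfl⟩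

theorem interior_subset_region (S : Set ι) (i : ι) : A.arc i \ A.pts ⊆ A.region S i :=
  (A.isPreconnected_interior i).subset_connectedComponentIn (A.interior_nonempty i).some_mem
    (A.interior_subset_compl i (by simp))

theorem arc_sdiff_region (S : Set ι) (i : ι) : A.arc i \ {A.src i, A.tgt i} ⊆ A.region S i :=
  A.interior_eq i ▸ A.interior_subset_region S i

theorem notMem_region_of_mem_pts {p : ℝ × ℝ} (hp : p ∈ A.pts) : p ∉ A.region S i := fun h =>
  (A.isFaceOf_region S i).subset_compl h (A.pts_subset_carrier hp)

theorem subset_region_of_mem (hi : i ∈ S) (hf : IsFaceOf (A.carrier S) f) {z : ℝ × ℝ}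
    (hz : z ∈ f) (hzF : z ∈ A.region S i) : f ⊆ A.region S i := by
  refine (A.isFaceOf_region S i).subset_of_isPreconnected hf.isPreconnected
    (hf.subset_compl.trans (compl_subset_compl.2 ?_)) ⟨z, hz, hzF⟩
  rw [A.carrier_eq_insert hi]
  exact subset_union_left

theorem notMem_carrier_of_mem_region (hi : i ∈ S) {z : ℝ × ℝ} (hz : z ∈ A.region S i \ A.arc i) :
    z ∉ A.carrier S := by
  rw [A.carrier_eq_insert hi]
  rintro (h | h)
  exacts [(A.isFaceOf_region S i).subset_compl hz.1 h, hz.2 h]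

/-- An arc which is not drawn lies in the closure of a single face. -/
theorem exists_isFaceOf_arc_subset_closure (hi : i ∉ S) :
    ∃ g, IsFaceOf (A.carrier S) g ∧ A.arc i ⊆ closure g := by
  obtain ⟨g, hg, hig⟩ := exists_isFaceOf_of_isPreconnected (A.isPreconnected_interior i)
    (A.interior_nonempty i) (A.interior_subset_compl i hi)
  exact ⟨g, hg, (A.subset_closure_interior i).trans (closure_mono hig)⟩

variable [Finite ι]

theorem isClosed_carrier (S : Set ι) : IsClosed (A.carrier S) :=
  A.finite_pts.isClosed.union (S.toFinite.isClosed_biUnion fun i _ => (A.isArc i).isCompact.isClosed)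

theorem face_subset_region (hi : i ∈ S) (hf : IsFaceOf (A.carrier S) f) {q : ℝ × ℝ}
    (hq : q ∈ A.arc i \ A.pts) (hqf : q ∈ closure f) : f ⊆ A.region S i := by
  refine (A.isFaceOf_region S i).subset_of_isPreconnected hf.isPreconnected
    (hf.subset_compl.trans (compl_subset_compl.2 ?_)) ?_
  · rw [A.carrier_eq_insert hi]
    exact subset_union_left
  · rw [inter_comm]
    exact mem_closure_iff.1 hqf _ ((A.isFaceOf_region S i).isOpen (A.isClosed_carrier _))
      (A.interior_subset_region S i hq)

theorem arc_subset_closure (hi : i ∈ S) (hf : IsFaceOf (A.carrier S) f) {q : ℝ × ℝ}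
    (hq : q ∈ A.arc i \ A.pts) (hqf : q ∈ closure f) : A.arc i ⊆ closure f := by
  by_contra hne
  have hfF := A.face_subset_region hi hf hq hqf
  set F := A.region S i with hF
  have hFf := A.isFaceOf_region S i
  have hFo := hFf.isOpen (A.isClosed_carrier _)
  have hint := A.arc_sdiff_region S i
  have hpa : A.src i ∉ F := A.notMem_region_of_mem_pts (A.src_mem i)
  have hpb : A.tgt i ∉ F := A.notMem_region_of_mem_pts (A.tgt_mem i)
  have hcar := A.carrier_eq_insert hi
  have hfc := hf.closure_subset (A.isClosed_carrier S)
  have hfo := hf.isOpen (A.isClosed_carrier S)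
  have hfd := hf.subset_compl
  obtain ⟨γ, hc, hinj, h0, h1, he⟩ := A.isArc i
  rw [← h0] at hpa
  rw [← h1] at hpb
  rw [← he] at hne hint hcar
  rw [← h0, ← h1, image_Icc_sdiff_ends hinj] at hint
  have hco : ContinuousOn γ (Ioo 0 1) := hc.mono Ioo_subset_Icc_self
  have ho : IsOpen (Ioo 0 1 ∩ γ ⁻¹' (closure f)ᶜ) :=
    hco.isOpen_inter_preimage isOpen_Ioo isClosed_closure.isOpen_compl
  obtain ⟨t₁, ht₁⟩ : (Ioo 0 1 ∩ γ ⁻¹' (closure f)ᶜ).Nonempty := by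
    by_contra hemp
    refine hne ?_
    have : γ '' Ioo 0 1 ⊆ closure f := by
      rintro _ ⟨t, ht, rfl⟩
      by_contra h
      exact hemp ⟨t, ht, h⟩
    rw [← closure_Ioo (zero_ne_one' ℝ)] at hc ⊢
    exact hc.image_closure.trans (closure_minimal this isClosed_closure)
  obtain ⟨ε, hε, hball⟩ := Metric.isOpen_iff.1 ho t₁ ht₁
  set s := t₁ - ε / 2 with hs
  set t := t₁ + ε / 2 with ht
  have hst : s < t := by linarith
  have hsub : Icc s t ⊆ Ioo 0 1 ∩ γ ⁻¹' (closure f)ᶜ := fun u hu => hball (by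
    rw [Metric.mem_ball, Real.dist_eq, abs_lt]
    constructor <;> linarith [hu.1, hu.2])
  have hs0 : 0 < s := (hsub (left_mem_Icc.2 hst.le)).1.1
  have ht1 : t < 1 := (hsub (right_mem_Icc.2 hst.le)).1.2
  have i₁ : Icc 0 s ⊆ Icc (0 : ℝ) 1 := Icc_subset_Icc_right (by linarith)
  have i₂ : Icc t 1 ⊆ Icc (0 : ℝ) 1 := Icc_subset_Icc_left (by linarith)
  have a₁ := isArc_image_Icc hs0 (hc.mono i₁) (hinj.mono i₁)
  have a₂ := isArc_image_Icc ht1 (hc.mono i₂) (hinj.mono i₂)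
  set e₁ := γ '' Icc 0 s with he₁
  set e₂ := γ '' Icc t 1 with he₂
  have w₁ : IsPreconnected (F \ e₁) := by
    refine a₁.isPreconnected_diff hFo hFf.isPreconnected a₁.left_mem hpa ?_
    rintro _ ⟨⟨u, hu, rfl⟩, hu0⟩
    refine hint ⟨u, ⟨lt_of_le_of_ne hu.1 ?_, by linarith [hu.2]⟩, rfl⟩
    rintro rfl
    exact hu0 rfl
  have w₂ : IsPreconnected ((F \ e₁) \ e₂) := by
    refine a₂.isPreconnected_diff (hFo.sdiff a₁.isCompact.isClosed) w₁ a₂.right_mem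
      (fun h => hpb h.1) ?_
    rintro _ ⟨⟨u, hu, rfl⟩, hu0⟩
    refine ⟨hint ⟨u, ⟨by linarith [hu.1], lt_of_le_of_ne hu.2 ?_⟩, rfl⟩, ?_⟩
    · rintro rfl
      exact hu0 rfl
    · rintro ⟨v, hv, hvu⟩
      have := hinj (i₁ hv) (i₂ hu) hvu
      linarith [hv.2, hu.1]
  have hfW : f ⊆ (F \ e₁) \ e₂ := fun z hz => by
    have hze : z ∉ γ '' Icc 0 1 := fun h => hfd hz (hcar ▸ Or.inr h)
    exact ⟨⟨hfF hz, fun h => hze (image_mono i₁ h)⟩, fun h => hze (image_mono i₂ h)⟩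
  obtain ⟨x, hx⟩ := hf.nonempty
  have hWf : (F \ e₁) \ e₂ ⊆ f := by
    refine w₂.subset_of_closure_inter_subset hfo ⟨x, hfW hx, hx⟩ ?_
    rintro z ⟨hzc, ⟨hzF, hz₁⟩, hz₂⟩
    refine (hfc hzc).resolve_right fun hzS => ?_
    rw [hcar] at hzS
    rcases hzS with hzS | ⟨u, hu, rfl⟩
    · exact hFf.subset_compl hzF hzS
    · rcases le_or_gt u s with hus | hus
      · exact hz₁ ⟨u, ⟨hu.1, hus⟩, rfl⟩
      rcases le_or_gt t u with hut | hut
      · exact hz₂ ⟨u, ⟨hut, hu.2⟩, rfl⟩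
      exact (hsub ⟨hus.le, hut.le⟩).2 hzc
  have hm : γ t₁ ∈ f := by
    refine hWf ⟨⟨hint ⟨t₁, ht₁.1, rfl⟩, ?_⟩, ?_⟩
    · rintro ⟨v, hv, hvu⟩
      have := hinj (i₁ hv) (Ioo_subset_Icc_self ht₁.1) hvu
      linarith [hv.2]
    · rintro ⟨v, hv, hvu⟩
      have := hinj (i₂ hv) (Ioo_subset_Icc_self ht₁.1) hvu
      linarith [hv.1]
  exact ht₁.2 (subset_closure hm)

theorem arc_subset_closure_iff (hi : i ∈ S) (hf : IsFaceOf (A.carrier S) f) :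
    A.arc i ⊆ closure f ↔ f ⊆ A.region S i := by
  obtain ⟨q, hq⟩ := A.interior_nonempty i
  refine ⟨fun h => A.face_subset_region hi hf hq (h hq.1), fun hfF => ?_⟩
  by_contra hne
  have hF := A.isFaceOf_region S i
  obtain ⟨x, hx⟩ := hf.nonempty
  have : A.region S i ⊆ f := by
    refine hF.isPreconnected.subset_of_closure_inter_subset (hf.isOpen (A.isClosed_carrier S))
      ⟨x, hfF hx, hx⟩ ?_
    rintro z ⟨hzc, hzF⟩
    refine (hf.closure_subset (A.isClosed_carrier S) hzc).resolve_right fun hzS => ?_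
    rw [A.carrier_eq_insert hi] at hzS
    rcases hzS with hzS | hzS
    · exact hF.subset_compl hzF hzS
    · exact hne (A.arc_subset_closure hi hf
        ⟨hzS, fun h => A.notMem_region_of_mem_pts h hzF⟩ hzc)
  exact hf.subset_compl (this (A.interior_subset_region S i hq))
    (A.arc_subset_carrier hi hq.1)

/-- At most two faces are incident with an arc. -/
theorem eq_or_eq_of_arc_subset_closure (hi : i ∈ S) {f₁ f₂ f₃ : Set (ℝ × ℝ)}
    (h₁ : IsFaceOf (A.carrier S) f₁) (h₂ : IsFaceOf (A.carrier S) f₂)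
    (h₃ : IsFaceOf (A.carrier S) f₃) (hi₁ : A.arc i ⊆ closure f₁) (hi₂ : A.arc i ⊆ closure f₂)
    (hi₃ : A.arc i ⊆ closure f₃) (h₁₂ : f₁ ≠ f₂) : f₃ = f₁ ∨ f₃ = f₂ := by
  by_contra! hne
  have hcl := A.isClosed_carrier S
  have hF := A.isFaceOf_region S i
  rw [A.arc_subset_closure_iff hi h₁] at hi₁
  rw [A.arc_subset_closure_iff hi h₂] at hi₂
  rw [A.arc_subset_closure_iff hi h₃] at hi₃
  have hdisj : ∀ {f}, IsFaceOf (A.carrier S) f → f ⊆ A.region S i → f ⊆ A.region S i \ A.arc i :=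
    fun hf hfF z hz => ⟨hfF hz, fun h => hf.subset_compl hz (A.arc_subset_carrier hi h)⟩
  refine (A.isArc i).not_three_pieces
    (S₃ := ⋃₀ {g | IsFaceOf (A.carrier S) g ∧ g ⊆ A.region S i ∧ g ≠ f₁ ∧ g ≠ f₂})
    (hF.isOpen (A.isClosed_carrier _)) hF.isPreconnected
    (A.notMem_region_of_mem_pts (A.src_mem i)) (A.notMem_region_of_mem_pts (A.tgt_mem i))
    (A.arc_sdiff_region S i) (h₁.isOpen hcl) (h₂.isOpen hcl)
    (isOpen_sUnion fun g hg => hg.1.isOpen hcl) h₁.nonempty h₂.nonempty ?_ (h₁.disjoint h₂ h₁₂)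
    (disjoint_sUnion_right.2 fun g hg => h₁.disjoint hg.1 hg.2.2.1.symm)
    (disjoint_sUnion_right.2 fun g hg => h₂.disjoint hg.1 hg.2.2.2.symm) ?_
  · exact h₃.nonempty.mono (subset_sUnion_of_mem ⟨h₃, hi₃, hne⟩)
  · refine Subset.antisymm (union_subset (union_subset (hdisj h₁ hi₁) (hdisj h₂ hi₂))
      (sUnion_subset fun g hg => hdisj hg.1 hg.2.1)) fun z hz => ?_
    obtain ⟨g, hg, hzg⟩ := exists_isFaceOf (A.notMem_carrier_of_mem_region hi hz)
    by_cases hg₁ : g = f₁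
    · exact Or.inl (Or.inl (hg₁ ▸ hzg))
    by_cases hg₂ : g = f₂
    · exact Or.inl (Or.inr (hg₂ ▸ hzg))
    exact Or.inr ⟨g, ⟨hg, A.subset_region_of_mem hi hg hzg hz.1, hg₁, hg₂⟩, hzg⟩

/-- An arc on a closed curve of the drawing has a face on its other side. -/
theorem exists_ne_arc_subset_closure (hi : i ∈ S)
    (hj : JoinedIn (A.carrier (S \ {i})) (A.src i) (A.tgt i)) (f : Set (ℝ × ℝ))
    (hf : IsFaceOf (A.carrier S) f) (hif : A.arc i ⊆ closure f) :
    ∃ g, IsFaceOf (A.carrier S) g ∧ A.arc i ⊆ closure g ∧ g ≠ f := by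
  have hF := A.isFaceOf_region S i
  have hnp := (A.isArc i).not_isPreconnected_diff (hF.isOpen (A.isClosed_carrier _))
    (A.arc_sdiff_region S i) (hj.mono (subset_compl_comm.1 hF.subset_compl))
  rw [A.arc_subset_closure_iff hi hf] at hif
  obtain ⟨z, hz, hzf⟩ : ∃ z ∈ A.region S i \ A.arc i, z ∉ f := by
    by_contra! h
    refine hnp ?_
    rw [Subset.antisymm h fun z hz =>
      ⟨hif hz, fun h => hf.subset_compl hz (A.arc_subset_carrier hi h)⟩]
    exact hf.isPreconnected
  obtain ⟨g, hg, hzg⟩ := exists_isFaceOf (A.notMem_carrier_of_mem_region hi hz)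
  exact ⟨g, hg, (A.arc_subset_closure_iff hi hg).2 (A.subset_region_of_mem hi hg hzg hz.1),
    fun h => hzf (h ▸ hzg)⟩

/-- A face is still a face after deleting arcs it is not incident with. -/
theorem isFaceOf_mono {S₀ : Set ι} (hS : S₀ ⊆ S) (hf : IsFaceOf (A.carrier S) f)
    (h : ∀ i ∈ S, A.arc i ⊆ closure f → i ∈ S₀) : IsFaceOf (A.carrier S₀) f := by
  have hcl := A.isClosed_carrier S
  refine isFaceOf_of_closure_subset (hf.isOpen hcl) hf.isPreconnected hf.nonempty
    (hf.subset_compl.trans (compl_subset_compl.2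
      (union_subset_union_right _ (biUnion_subset_biUnion_left hS)))) fun z hz => ?_
  rcases hf.closure_subset hcl hz with hzf | hzS
  · exact Or.inl hzf
  by_cases hzp : z ∈ A.pts
  · exact Or.inr (A.pts_subset_carrier hzp)
  obtain ⟨i, hi, hzi⟩ := mem_iUnion₂.1 (hzS.resolve_left hzp)
  exact Or.inr (A.arc_subset_carrier
    (h i hi (A.arc_subset_closure hi hf ⟨hzi, hzp⟩ hz)) hzi)

/-- A non-isolated vertex on the boundary of a face lies on an arc on the boundary. -/
theorem exists_arc_subset_closure_of_mem_pts (hf : IsFaceOf (A.carrier S) f) {p : ℝ × ℝ}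
    (hp : p ∈ A.pts) (hpf : p ∈ closure f) (hi : i ∈ S) (hpi : p ∈ A.arc i) :
    ∃ j ∈ S, p ∈ A.arc j ∧ A.arc j ⊆ closure f := by
  by_contra! hne
  have hcl := A.isClosed_carrier S
  have hK : IsClosed (A.pts \ {p} ∪ ⋃ j ∈ {j | p ∉ A.arc j}, A.arc j) :=
    (A.finite_pts.subset sdiff_subset).isClosed.union
      ((toFinite _).isClosed_biUnion fun j _ => (A.isArc j).isCompact.isClosed)
  obtain ⟨B, hB, hpB, hBK, hBc⟩ := exists_isOpen_isPreconnected_punctured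
    (hK.isOpen_compl.mem_nhds (x := p) (by
      rintro (h | h)
      · exact h.2 rfl
      · obtain ⟨j, hj, hpj⟩ := mem_iUnion₂.1 h
        exact hj hpj))
  have hpt : ∀ z ∈ B \ {p}, z ∉ A.pts := fun z hz h => hBK hz.1 (Or.inl ⟨h, hz.2⟩)
  have hsub : B \ {p} ⊆ f := by
    refine hBc.subset_of_closure_inter_subset (hf.isOpen hcl) ?_ ?_
    · obtain ⟨z, hzB, hzf⟩ := mem_closure_iff.1 hpf B hB hpB
      exact ⟨z, ⟨hzB, fun h => hf.subset_compl hzf (A.pts_subset_carrier (h ▸ hp))⟩, hzf⟩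
    · rintro z ⟨hzc, hz⟩
      refine (hf.closure_subset hcl hzc).resolve_right fun hzS => ?_
      obtain ⟨j, hj, hzj⟩ := mem_iUnion₂.1 (hzS.resolve_left (hpt z hz))
      have hpj : p ∈ A.arc j := by
        by_contra h
        exact hBK hz.1 (Or.inr (mem_iUnion₂.2 ⟨j, h, hzj⟩))
      exact hne j hj hpj (A.arc_subset_closure hj hf ⟨hzj, hpt z hz⟩ hzc)
  obtain ⟨z, hzB, hzi, hzp⟩ := mem_closure_iff.1 (A.subset_closure_interior i hpi) B hB hpB
  exact hf.subset_compl (hsub ⟨hzB, fun h => hzp (h ▸ hp)⟩) (A.arc_subset_carrier hi hzi)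

/-- A boundary arc of a face with different faces on both sides is continued at its endpoints by
other boundary arcs of the face. -/
theorem exists_ne_arc_of_mem_pts (hf : IsFaceOf (A.carrier S) f) (hg : IsFaceOf (A.carrier S) g)
    (hgf : g ≠ f) (hi : i ∈ S) (hif : A.arc i ⊆ closure f) (hig : A.arc i ⊆ closure g)
    {p : ℝ × ℝ} (hp : p ∈ A.pts) (hpi : p ∈ A.arc i) :
    ∃ j ∈ S, j ≠ i ∧ p ∈ A.arc j ∧ A.arc j ⊆ closure f := by
  by_contra! hne
  obtain ⟨q, harc, hq, hpq⟩ : ∃ q, IsArc (A.arc i) q p ∧ q ∈ A.pts ∧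
      A.arc i ∩ A.pts = {p, q} := by
    have h : p ∈ ({A.src i, A.tgt i} : Set (ℝ × ℝ)) := (A.arc_inter_pts i).subset ⟨hpi, hp⟩
    rcases h with h | h
    · exact ⟨_, h ▸ (A.isArc i).symm, A.tgt_mem i, h ▸ A.arc_inter_pts i⟩
    · rw [mem_singleton_iff] at h
      exact ⟨_, h ▸ A.isArc i, A.src_mem i, by rw [A.arc_inter_pts i, h, pair_comm]⟩
  set S₁ : Set ι := {j | j ∈ S ∧ A.arc j ⊆ closure f} with hS₁
  have hf₁ := A.isFaceOf_mono (S₀ := S₁) (fun j hj => hj.1) hf fun j hj hjf => ⟨hj, hjf⟩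
  set D : Set (ℝ × ℝ) := A.pts \ {p} ∪ ⋃ j ∈ S₁ \ {i}, A.arc j with hD
  have hDc : IsClosed D := (A.finite_pts.subset sdiff_subset).isClosed.union
    ((toFinite _).isClosed_biUnion fun j _ => (A.isArc j).isCompact.isClosed)
  have hDS : D ⊆ A.carrier S := union_subset_union sdiff_subset
    (biUnion_subset_biUnion_left fun j hj => hj.1.1)
  have hqD : q ∈ D := Or.inl ⟨hq, harc.ne⟩
  have hiD : A.arc i \ {q} ⊆ Dᶜ := by
    rintro z ⟨hzi, hzq⟩ (h | h)
    · rcases hpq.subset ⟨hzi, h.1⟩ with h' | h'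
      exacts [h.2 h', hzq h']
    · obtain ⟨j, hj, hzj⟩ := mem_iUnion₂.1 h
      have hzp := A.arc_inter i j (Ne.symm hj.2) ⟨hzi, hzj⟩
      rcases hpq.subset ⟨hzi, hzp⟩ with h' | h'
      · exact hne j hj.1.1 hj.2 (h' ▸ hzj) hj.1.2
      · exact hzq h'
  obtain ⟨F, hF, hiF⟩ := exists_isFaceOf_of_isPreconnected harc.symm.isPreconnected_sdiff_right
    ⟨p, hpi, fun h => harc.ne h.symm⟩ hiD
  have hFo := hF.isOpen hDc
  have hpF : p ∈ F := hiF ⟨hpi, fun h => harc.ne h.symm⟩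
  have hsub : ∀ {h}, IsFaceOf (A.carrier S) h → A.arc i ⊆ closure h → h ⊆ F \ A.arc i := by
    intro h hh hih z hz
    refine ⟨hF.subset_of_isPreconnected hh.isPreconnected
      (hh.subset_compl.trans (compl_subset_compl.2 hDS)) ?_ hz,
      fun hzi => hh.subset_compl hz (A.arc_subset_carrier hi hzi)⟩
    rw [inter_comm]
    exact mem_closure_iff.1 (hih hpi) F hFo hpF
  have hpre : IsPreconnected (F \ A.arc i) :=
    harc.isPreconnected_diff hFo hF.isPreconnected harc.left_mem (fun h => hF.subset_compl h hqD) hiF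
  have hFf : F \ A.arc i ⊆ f := by
    obtain ⟨x, hx⟩ := hf.nonempty
    refine hf₁.subset_of_isPreconnected hpre ?_ ⟨x, hsub hf hif hx, hx⟩
    rintro z ⟨hzF, hzi⟩ (h | h)
    · by_cases hzp : z = p
      · exact hzi (hzp ▸ hpi)
      · exact hF.subset_compl hzF (Or.inl ⟨h, hzp⟩)
    · obtain ⟨j, hj, hzj⟩ := mem_iUnion₂.1 h
      by_cases hji : j = i
      · exact hzi (hji ▸ hzj)
      · exact hF.subset_compl hzF (Or.inr (mem_iUnion₂.2 ⟨j, ⟨hj, hji⟩, hzj⟩))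
  obtain ⟨x, hx⟩ := hg.nonempty
  exact hgf (hg.eq_of_inter hf ⟨x, hx, hFf (hsub hg hig hx)⟩)

end ArcSystem

section Drawing

variable {V : Type*} {G : SimpleGraph V}

theorem pos_mem_arcSet_iff (emb : PlaneEmbedding G) {e : Sym2 V} (he : e ∈ G.edgeSet) {v : V} :
    emb.pos v ∈ arcSet emb e ↔ v ∈ e := by
  induction e with | _ a b
  rw [SimpleGraph.mem_edgeSet] at he
  rw [Sym2.mem_iff]
  refine ⟨emb.arc_vertex a b he v, ?_⟩
  obtain ⟨γ, -, -, h0, h1, h⟩ := emb.arc_curve a b he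
  change _ → emb.pos v ∈ emb.arc a b
  rw [← h]
  rintro (rfl | rfl)
  exacts [⟨0, by simp, h0⟩, ⟨1, by simp, h1⟩]

/-- The arcs of a plane embedding of a finite graph as a system of arcs. -/
def edgeArcs [Finite V] (emb : PlaneEmbedding G) : ArcSystem G.edgeSet where
  pts := range emb.pos
  arc e := arcSet emb e
  src e := emb.pos e.1.out.1
  tgt e := emb.pos e.1.out.2
  finite_pts := finite_range _
  isArc e := by
    have h : s(e.1.out.1, e.1.out.2) = e.1 := Quot.out_eq e.1
    have hadj : G.Adj e.1.out.1 e.1.out.2 := by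
      rw [← SimpleGraph.mem_edgeSet, h]
      exact e.2
    conv => enter [1]; rw [← h]
    exact emb.arc_curve _ _ hadj
  arc_inter_pts e := by
    ext p
    constructor
    · rintro ⟨hp, v, rfl⟩
      have h : s(e.1.out.1, e.1.out.2) = e.1 := Quot.out_eq e.1
      rw [pos_mem_arcSet_iff emb e.2, ← h] at hp
      exact (Sym2.mem_iff.1 hp).imp (congrArg emb.pos) (congrArg emb.pos)
    · rintro (rfl | rfl)
      · exact ⟨(pos_mem_arcSet_iff emb e.2).2 (Sym2.out_fst_mem _), mem_range_self _⟩
      · exact ⟨(pos_mem_arcSet_iff emb e.2).2 (Sym2.out_snd_mem _), mem_range_self _⟩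
  arc_inter := by
    rintro ⟨e, he⟩ ⟨e', he'⟩ h
    induction e with | _ a b
    induction e' with | _ c d
    exact emb.arc_inter a b c d he he' fun h' => h (Subtype.ext h')

/-- The drawing of the edges in `T`, together with all vertices. -/
def drawing (emb : PlaneEmbedding G) (T : Set (Sym2 V)) : Set (ℝ × ℝ) :=
  range emb.pos ∪ ⋃ e ∈ T, arcSet emb e

theorem drawingH_eq [Fintype V] (emb : PlaneEmbedding G) {x : V} (C : G.Walk x x) :
    drawingH emb C = drawing emb (Hgraph C).edgeSet := by
  ext z
  simp only [drawingH, drawingOn, drawing, image_univ, mem_union, mem_iUnion, mem_univ,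
    exists_prop, true_and]
  refine or_congr_right ⟨fun ⟨u, v, h, hz⟩ => ⟨s(u, v), h, hz⟩, fun ⟨e, he, hz⟩ => ?_⟩
  induction e with | _ u v
  exact ⟨u, v, he, hz⟩

theorem drawing_eq_carrier [Finite V] (emb : PlaneEmbedding G) {T : Set (Sym2 V)}
    (hT : T ⊆ G.edgeSet) : drawing emb T = (edgeArcs emb).carrier (Subtype.val ⁻¹' T) := by
  refine congrArg (range emb.pos ∪ ·) (subset_antisymm (iUnion₂_subset fun e he => ?_)
    (iUnion₂_subset fun e he => subset_biUnion_of_mem (u := arcSet emb) he))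
  exact subset_biUnion_of_mem (u := (edgeArcs emb).arc) (show (⟨e, hT he⟩ : G.edgeSet) ∈ _ from he)

theorem joinedIn_drawing (emb : PlaneEmbedding G) {T : Set (Sym2 V)} {a b : V} (p : G.Walk a b)
    (hp : ∀ e ∈ p.edges, e ∈ T) : JoinedIn (drawing emb T) (emb.pos a) (emb.pos b) := by
  induction p with
  | nil => exact JoinedIn.refl (Or.inl (mem_range_self _))
  | @cons a b c h p ih =>
    refine JoinedIn.trans ?_ (ih fun e he => hp e (by simp [he]))
    refine (show IsArc (emb.arc a b) _ _ from emb.arc_curve a b h).joinedIn.mono ?_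
    exact (subset_biUnion_of_mem (u := arcSet emb) (hp s(a, b) (by simp))).trans subset_union_right

variable {emb : PlaneEmbedding G} {T : Set (Sym2 V)} {f g : Set (ℝ × ℝ)}
  {e : Sym2 V} {v : V}

theorem incVertex_of_incEdge (he : e ∈ G.edgeSet) (hf : incEdge emb f e) (hv : v ∈ e) :
    incVertex emb f v :=
  hf ((pos_mem_arcSet_iff emb he).2 hv)

variable [Finite V]

/-- At most two faces are incident with an edge. -/
theorem eq_or_eq_of_incEdge (hT : T ⊆ G.edgeSet) (he : e ∈ T) {f₁ f₂ f₃ : Set (ℝ × ℝ)}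
    (h₁ : IsFaceOf (drawing emb T) f₁) (h₂ : IsFaceOf (drawing emb T) f₂)
    (h₃ : IsFaceOf (drawing emb T) f₃) (he₁ : incEdge emb f₁ e) (he₂ : incEdge emb f₂ e)
    (he₃ : incEdge emb f₃ e) (h₁₂ : f₁ ≠ f₂) : f₃ = f₁ ∨ f₃ = f₂ := by
  rw [drawing_eq_carrier emb hT] at h₁ h₂ h₃
  exact (edgeArcs emb).eq_or_eq_of_arc_subset_closure (i := ⟨e, hT he⟩) he h₁ h₂ h₃ he₁ he₂ he₃ h₁₂

/-- An edge on a cycle is incident with two faces. -/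
theorem exists_ne_incEdge (hT : T ⊆ G.edgeSet) {a b : V} (he : s(a, b) ∈ T) (p : G.Walk a b)
    (hp : ∀ e ∈ p.edges, e ∈ T \ {s(a, b)}) (hf : IsFaceOf (drawing emb T) f)
    (hfe : incEdge emb f s(a, b)) :
    ∃ g, IsFaceOf (drawing emb T) g ∧ incEdge emb g s(a, b) ∧ g ≠ f := by
  have hj := joinedIn_drawing emb p hp
  rw [drawing_eq_carrier emb (sdiff_subset.trans hT)] at hj
  rw [drawing_eq_carrier emb hT] at hf ⊢
  refine (edgeArcs emb).exists_ne_arc_subset_closure (i := ⟨s(a, b), hT he⟩) he ?_ f hf hfe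
  have h : s(s(a, b).out.1, s(a, b).out.2) = s(a, b) := Quot.out_eq _
  have hS : (Subtype.val ⁻¹' (T \ {s(a, b)}) : Set G.edgeSet) =
      Subtype.val ⁻¹' T \ {⟨s(a, b), hT he⟩} := by
    ext; simp [Subtype.ext_iff]
  rw [hS] at hj
  change JoinedIn _ (emb.pos s(a, b).out.1) (emb.pos s(a, b).out.2)
  rcases Sym2.eq_iff.1 h with ⟨h1, h2⟩ | ⟨h1, h2⟩ <;> rw [h1, h2]
  exacts [hj, hj.symm]

theorem isFaceOf_drawing_mono (hT : T ⊆ G.edgeSet) {T₀ : Set (Sym2 V)} (hT₀ : T₀ ⊆ T)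
    (hf : IsFaceOf (drawing emb T) f) (h : ∀ e ∈ T, incEdge emb f e → e ∈ T₀) :
    IsFaceOf (drawing emb T₀) f := by
  rw [drawing_eq_carrier emb (hT₀.trans hT)]
  rw [drawing_eq_carrier emb hT] at hf
  exact (edgeArcs emb).isFaceOf_mono (preimage_mono hT₀) hf fun i hi => h i hi

/-- A face incident with a non-isolated vertex is incident with an edge at this vertex. -/
theorem exists_incEdge_of_incVertex (hT : T ⊆ G.edgeSet) (hf : IsFaceOf (drawing emb T) f)
    (hv : incVertex emb f v) (he : e ∈ T) (hve : v ∈ e) :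
    ∃ e' ∈ T, v ∈ e' ∧ incEdge emb f e' := by
  rw [drawing_eq_carrier emb hT] at hf
  obtain ⟨⟨j, hj⟩, hjT, hvj, hjf⟩ := (edgeArcs emb).exists_arc_subset_closure_of_mem_pts
    (i := ⟨e, hT he⟩) hf (mem_range_self v) hv he ((pos_mem_arcSet_iff emb (hT he)).2 hve)
  exact ⟨j, hjT, (pos_mem_arcSet_iff emb hj).1 hvj, hjf⟩

/-- If an edge is incident with two faces, then each of these faces is incident with a further edge
at each end of this edge. -/
theorem exists_ne_incEdge_of_mem (hT : T ⊆ G.edgeSet) (hf : IsFaceOf (drawing emb T) f)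
    (hg : IsFaceOf (drawing emb T) g) (hgf : g ≠ f) (he : e ∈ T) (hfe : incEdge emb f e)
    (hge : incEdge emb g e) (hv : v ∈ e) :
    ∃ e' ∈ T, e' ≠ e ∧ v ∈ e' ∧ incEdge emb f e' := by
  rw [drawing_eq_carrier emb hT] at hf hg
  obtain ⟨⟨j, hj⟩, hjT, hne, hvj, hjf⟩ := (edgeArcs emb).exists_ne_arc_of_mem_pts
    (i := ⟨e, hT he⟩) hf hg hgf he hfe hge (mem_range_self v)
    ((pos_mem_arcSet_iff emb (hT he)).2 hv)
  exact ⟨j, hjT, fun h => hne (Subtype.ext h), (pos_mem_arcSet_iff emb hj).1 hvj, hjf⟩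

theorem exists_isFaceOf_incEdge (hT : T ⊆ G.edgeSet) (he : e ∈ G.edgeSet) (heT : e ∉ T) :
    ∃ g, IsFaceOf (drawing emb T) g ∧ incEdge emb g e := by
  rw [drawing_eq_carrier emb hT]
  exact (edgeArcs emb).exists_isFaceOf_arc_subset_closure (i := ⟨e, he⟩) heT

end Drawing

open SimpleGraph

section Cycles

variable {V : Type*} {G : SimpleGraph V} {x a b c d : V} {C : G.Walk x x}

theorem isCycle_cons {p : G.Walk b a} (hp : p.IsPath) (h : G.Adj a b) (hl : 2 ≤ p.length) :
    (p.cons h).IsCycle := by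
  refine (Walk.cons_isCycle_iff p h).2 ⟨hp, fun hm => ?_⟩
  cases p with
  | nil => simp at hl
  | @cons _ w _ h' q =>
    rw [Walk.cons_isPath_iff] at hp
    rw [Walk.edges_cons, List.mem_cons] at hm
    rcases hm with hm | hm
    · obtain rfl : a = w := by
        rw [Sym2.eq_swap] at hm
        exact Sym2.congr_right.1 hm
      have := Walk.length_eq_zero_iff.2 (Walk.isPath_iff_nil.1 hp.1)
      rw [Walk.length_cons] at hl
      omega
    · exact hp.2 (q.snd_mem_support_of_mem_edges hm)

/-- Deleting an edge from a cycle leaves a path. -/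
theorem exists_isPath_of_mem_edges (hC : C.IsCycle) (h : s(a, b) ∈ C.edges) :
    ∃ p : G.Walk b a, p.IsPath ∧ p.length + 1 = C.length ∧
      (∀ v, v ∈ p.support ↔ v ∈ C.support) ∧ (∀ e ∈ C.edges, e = s(a, b) ∨ e ∈ p.edges) ∧
      ∀ e ∈ p.edges, e ∈ C.edges ∧ e ≠ s(a, b) := by
  have hcons : ∀ (b : V) (h : G.Adj a b) (p : G.Walk b a), (p.cons h).IsCycle →
      p.IsPath ∧ (∀ v, v ∈ p.support ↔ v ∈ (p.cons h).support) ∧ ∀ e ∈ p.edges, e ≠ s(a, b) := by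
    intro b h p hp
    rw [Walk.cons_isCycle_iff] at hp
    refine ⟨hp.1, fun v => ?_, fun e he => ne_of_mem_of_not_mem he hp.2⟩
    rw [Walk.support_cons, List.mem_cons, iff_or_self]
    rintro rfl
    exact p.end_mem_support
  have ha := C.fst_mem_support_of_mem_edges h
  obtain ⟨C', hC', hl, hs, he⟩ : ∃ C' : G.Walk a a, C'.IsCycle ∧ C'.length = C.length ∧
      (∀ v, v ∈ C'.support ↔ v ∈ C.support) ∧ ∀ e, e ∈ C'.edges ↔ e ∈ C.edges :=
    ⟨C.rotate a ha, hC.rotate ha, C.length_rotate a ha, fun v => C.mem_support_rotate_iff a ha,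
      fun e => (C.rotate_edges a ha).mem_iff⟩
  simp only [← hl, ← hs, ← he] at h ⊢
  clear hl hs he ha
  cases C' with
  | nil => simp at h
  | @cons _ w _ hw p =>
    obtain ⟨hp, hps, hpe⟩ := hcons w hw p hC'
    rw [Walk.edges_cons, List.mem_cons] at h
    rcases h with h | h
    · obtain rfl := Sym2.congr_right.1 h
      exact ⟨p, hp, rfl, hps, by simp, fun e he => ⟨by simp [he], hpe e he⟩⟩
    · have hr := hC'.reverse
      obtain ⟨u, hu, q, hq⟩ := Walk.exists_eq_cons_of_ne hw.ne p.reverse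
      rw [Walk.reverse_cons, hq, Walk.cons_append] at hr
      obtain ⟨hp', hps', hpe'⟩ := hcons u hu _ hr
      have hpr : p = (q.cons hu).reverse := by rw [← hq, Walk.reverse_reverse]
      have hbu : b = u := by
        rw [hpr, Walk.edges_reverse, List.mem_reverse] at h
        have hqp : (q.cons hu).IsPath := hq ▸ hp.reverse
        simpa using hqp.eq_snd_of_mem_edges h
      subst hbu
      refine ⟨_, hp', ?_, fun v => ?_, ?_, ?_⟩
      · simp [hpr]
      · rw [hps', ← Walk.cons_append, ← hq, ← Walk.reverse_cons, Walk.support_reverse,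
          List.mem_reverse]
      · intro e
        simp only [hpr, Walk.edges_cons, Walk.edges_reverse, List.mem_cons, List.mem_reverse,
          Walk.edges_append, List.mem_append, Walk.edges_nil, List.not_mem_nil, or_false,
          Sym2.eq_swap (a := w) (b := a)]
        tauto
      · intro e he
        refine ⟨?_, hpe' e he⟩
        revert he
        simp only [hpr, Walk.edges_cons, Walk.edges_reverse, List.mem_cons, List.mem_reverse,
          Walk.edges_append, List.mem_append, Walk.edges_nil, List.not_mem_nil, or_false,
          Sym2.eq_swap (a := w) (b := a)]
        tauto

theorem exists_eq_cons_of_isPath {p : G.Walk b a} (hp : p.IsPath) (h : s(b, c) ∈ p.edges) :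
    ∃ (hbc : G.Adj b c) (q : G.Walk c a), p = q.cons hbc ∧ q.IsPath ∧ b ∉ q.support := by
  cases p with
  | nil => simp at h
  | cons hbc q =>
    obtain rfl : c = _ := by simpa using hp.eq_snd_of_mem_edges h
    rw [Walk.cons_isPath_iff] at hp
    exact ⟨hbc, q, rfl, hp⟩

/-- Deleting the inner vertices of a subpath with three edges from a cycle leaves a path. -/
theorem exists_isPath_of_three_edges (hC : C.IsCycle) (hab : s(a, b) ∈ C.edges)
    (hbc : s(b, c) ∈ C.edges) (hcd : s(c, d) ∈ C.edges) (hac : a ≠ c) (hbd : b ≠ d) :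
    ∃ q : G.Walk d a, q.IsPath ∧ q.length + 3 = C.length ∧ b ∉ q.support ∧ c ∉ q.support ∧
      (∀ v ∈ q.support, v ∈ C.support) ∧
      ∀ v ∈ C.support, v = b ∨ v = c ∨ v ∈ q.support := by
  obtain ⟨p, hp, hpl, hps, hpe, -⟩ := exists_isPath_of_mem_edges hC hab
  have hbc' : s(b, c) ∈ p.edges := (hpe _ hbc).resolve_left fun h => by
    rw [Sym2.eq_swap] at h
    exact hac (Sym2.congr_left.1 h).symm
  obtain ⟨h₁, q, rfl, hq, hbq⟩ := exists_eq_cons_of_isPath hp hbc'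
  have hbd' : s(c, d) ≠ s(b, c) := fun h => by
    rw [Sym2.eq_swap] at h
    exact hbd (Sym2.congr_left.1 h).symm
  have hcd' : s(c, d) ∈ q.edges := by
    have := hpe _ hcd
    rw [Walk.edges_cons, List.mem_cons] at this
    rcases this with h | h | h
    · have hc : c ∈ s(a, b) := h ▸ Sym2.mem_mk_left c d
      rcases Sym2.mem_iff.1 hc with rfl | rfl
      exacts [(hac rfl).elim, (h₁.ne rfl).elim]
    · exact (hbd' h).elim
    · exact h
  obtain ⟨h₂, r, rfl, hr, hcr⟩ := exists_eq_cons_of_isPath hq hcd'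
  rw [Walk.support_cons, List.mem_cons, not_or] at hbq
  simp only [Walk.support_cons, List.mem_cons, Walk.length_cons] at hps hpl
  exact ⟨r, hr, by omega, hbq.2, hcr, fun v hv => (hps v).1 (by tauto), fun v hv => (hps v).2 hv⟩

theorem eq_of_mem_edges (hC : C.IsCycle) (hab : s(a, b) ∈ C.edges) (hbc : s(b, c) ∈ C.edges)
    (hac : a ≠ c) (hbd : s(b, d) ∈ C.edges) : d = a ∨ d = c := by
  obtain ⟨p, hp, -, -, hpe, -⟩ := exists_isPath_of_mem_edges hC hab
  have key : ∀ w, s(b, w) ∈ C.edges → w = a ∨ w = p.snd := fun w hw => by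
    rcases hpe _ hw with h | h
    · rw [Sym2.eq_swap] at h
      exact Or.inl (Sym2.congr_left.1 h)
    · exact Or.inr (hp.eq_snd_of_mem_edges h)
  have h := (key c hbc).resolve_left hac.symm
  rw [h]
  exact key d hbd

end Cycles

section Longest

variable {V : Type*} {G : SimpleGraph V} {x a b c d v : V} {C : G.Walk x x}

theorem Hgraph_edgeSet_subset (C : G.Walk x x) : (Hgraph C).edgeSet ⊆ G.edgeSet :=
  edgeSet_mono (G.deleteEdges_le _)

theorem mem_edgeSet_Hgraph {e : Sym2 V} :
    e ∈ (Hgraph C).edgeSet ↔ e ∈ G.edgeSet ∧ (e ∈ C.edges ∨ ∃ v ∈ e, v ∉ C.support) := by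
  rw [Hgraph, edgeSet_deleteEdges, chordSet]
  simp only [mem_sdiff, mem_ofPred_eq, not_and, not_forall, ← or_iff_not_imp_left]
  simp only [exists_prop]
  tauto

theorem mem_edgeSet_Hgraph_of_mem_edges {e : Sym2 V} (he : e ∈ C.edges) :
    e ∈ (Hgraph C).edgeSet :=
  mem_edgeSet_Hgraph.2 ⟨C.edges_subset_edgeSet he, Or.inl he⟩

/-- An edge of `H` which is not on the cycle is incident with a vertex off the cycle. -/
theorem exists_eq_of_mem_edgeSet_Hgraph {e : Sym2 V} (he : e ∈ (Hgraph C).edgeSet) :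
    e ∈ C.edges ∨ ∃ v a, e = s(v, a) ∧ v ∉ C.support ∧ G.Adj v a := by
  obtain ⟨he, h | ⟨v, ⟨a, rfl⟩, hv⟩⟩ := mem_edgeSet_Hgraph.1 he
  exacts [Or.inl h, Or.inr ⟨v, a, rfl, hv, he⟩]

theorem exists_walk_of_mem_support (ha : a ∈ C.support) (hb : b ∈ C.support) :
    ∃ p : G.Walk a b, ∀ e ∈ p.edges, e ∈ C.edges := by
  refine ⟨(C.takeUntil a ha).reverse.append (C.takeUntil b hb), fun e he => ?_⟩
  rw [Walk.edges_append, Walk.edges_reverse, List.mem_append, List.mem_reverse] at he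
  exact he.elim (fun h => C.edges_takeUntil_subset_edges ha h) fun h => C.edges_takeUntil_subset_edges hb h

variable [Fintype V]

/-- In a 3-connected graph, no two vertices contain all neighbours of a third one. -/
theorem exists_adj_ne_ne (hG : ThreeConnected G) (hab : a ≠ b) (hcb : c ≠ b) :
    ∃ w, G.Adj b w ∧ w ≠ a ∧ w ≠ c := by
  obtain ⟨w, hw⟩ : ∃ w, w ∉ ({a, b, c} : Finset V) := by
    by_contra! h
    have h1 := hG.1
    rw [← Finset.card_univ, ← Finset.eq_univ_of_forall h] at h1
    have := Finset.card_le_three (a := a) (b := b) (c := c)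
    omega
  simp only [Finset.mem_insert, Finset.mem_singleton, not_or] at hw
  have hcon := hG.2 {a, c} Finset.card_le_two
  have hb : b ∈ ((({a, c} : Finset V) : Set V)ᶜ) := by simp [hab.symm, hcb.symm]
  have hw' : w ∈ ((({a, c} : Finset V) : Set V)ᶜ) := by simp [hw.1, hw.2.2]
  obtain ⟨⟨u, hu⟩, hbu, -⟩ := Walk.exists_eq_cons_of_ne (u := (⟨b, hb⟩ : {v // v ∈ _})) (v := ⟨w, hw'⟩)
    (fun h => hw.2.1 (congrArg Subtype.val h).symm) (hcon.preconnected _ _).some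
  simp only [Finset.coe_insert, Finset.coe_singleton, mem_compl_iff, mem_insert_iff,
    mem_singleton_iff, not_or] at hu
  exact ⟨u, hbu, hu⟩

theorem length_le_of_support_subset (hC : IsLongestIsolatingCycle G C) {y : V} {C' : G.Walk y y}
    (hC' : C'.IsCycle) (h : ∀ w ∈ C.support, w ∈ C'.support) : C'.length ≤ C.length :=
  hC.2.2 y C' hC' fun v hv => ⟨(hC.2.1 v fun h' => hv (h v h')).1,
    fun w hw => h w ((hC.2.1 v fun h' => hv (h v h')).2 w hw)⟩

/-- A longest isolating cycle has no extendable edge. -/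
theorem not_adj_of_adj (hC : IsLongestIsolatingCycle G C) (hab : s(a, b) ∈ C.edges)
    (hv : v ∉ C.support) (hva : G.Adj v a) : ¬ G.Adj v b := fun hvb => by
  obtain ⟨p, hp, hpl, hps, -, -⟩ := exists_isPath_of_mem_edges hC.1 hab
  have hc := hC.1.three_le_length
  have hp' : (p.cons hvb).IsPath := hp.cons fun h => hv ((hps v).1 h)
  have := length_le_of_support_subset hC (isCycle_cons hp' hva.symm (by simp; omega))
    fun w hw => by simp [hps w, hw]
  simp only [Walk.length_cons] at this
  omega

/-- The cycle `… a b c d …` cannot be rerouted as `… a v c b w d …`. -/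
theorem not_crossing_spokes (hC : IsLongestIsolatingCycle G C) (hab : s(a, b) ∈ C.edges)
    (hbc : s(b, c) ∈ C.edges) (hcd : s(c, d) ∈ C.edges) (hac : a ≠ c) (hbd : b ≠ d) {w : V}
    (hv : v ∉ C.support) (hw : w ∉ C.support) (hva : G.Adj v a) (hvc : G.Adj v c)
    (hwb : G.Adj w b) : ¬ G.Adj w d := fun hwd => by
  obtain ⟨q, hq, hql, hbq, hcq, hqs, hsq⟩ := exists_isPath_of_three_edges hC.1 hab hbc hcd hac hbd
  have hvw : v ≠ w := by
    rintro rfl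
    exact not_adj_of_adj hC hbc hv hwb hvc
  have hvq : v ∉ q.support := fun h => hv (hqs v h)
  have hwq : w ∉ q.support := fun h => hw (hqs w h)
  have hbC := C.fst_mem_support_of_mem_edges hbc
  have hcC := C.snd_mem_support_of_mem_edges hbc
  have hvb : v ≠ b := fun h => hv (h ▸ hbC)
  have hvc' : v ≠ c := fun h => hv (h ▸ hcC)
  have hwc : w ≠ c := fun h => hw (h ▸ hcC)
  have hcb : G.Adj c b := (C.adj_of_mem_edges hbc).symm
  have hp : ((((q.cons hwd).cons hwb.symm).cons hcb).cons hvc).IsPath := by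
    simp [Walk.cons_isPath_iff, *, hwb.ne', hcb.ne, hwc.symm]
  have := length_le_of_support_subset hC (isCycle_cons hp hva.symm (by simp))
    fun u hu => by
      rcases hsq u hu with h | h | h <;> simp [h]
  simp only [Walk.length_cons] at this
  omega

/-- The cycle `… a b c d …` cannot be rerouted as `… a c b v d …`. -/
theorem not_adj_of_spokes (hC : IsLongestIsolatingCycle G C) (hab : s(a, b) ∈ C.edges)
    (hbc : s(b, c) ∈ C.edges) (hcd : s(c, d) ∈ C.edges) (hac : a ≠ c) (hbd : b ≠ d)
    (hv : v ∉ C.support) (hvb : G.Adj v b) (hvd : G.Adj v d) : ¬ G.Adj a c := fun hadj => by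
  obtain ⟨q, hq, hql, hbq, hcq, hqs, hsq⟩ := exists_isPath_of_three_edges hC.1 hab hbc hcd hac hbd
  have hvq : v ∉ q.support := fun h => hv (hqs v h)
  have hcC := C.snd_mem_support_of_mem_edges hbc
  have hvc : v ≠ c := fun h => hv (h ▸ hcC)
  have hcb : G.Adj c b := (C.adj_of_mem_edges hbc).symm
  have hp : (((q.cons hvd).cons hvb.symm).cons hcb).IsPath := by
    simp [Walk.cons_isPath_iff, *, hvb.ne', hcb.ne, hvc.symm]
  have := length_le_of_support_subset hC (isCycle_cons hp hadj (by simp))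
    fun u hu => by
      rcases hsq u hu with h | h | h <;> simp [h]
  simp only [Walk.length_cons] at this
  omega

theorem mem_Vminus_union_Vplus (emb : PlaneEmbedding G) (C : G.Walk x x) :
    v ∈ Vminus emb C ∪ Vplus emb C ↔ v ∉ C.support := by
  simp only [Finset.mem_union, Vplus, Vminus, Finset.mem_filter, Finset.mem_univ, true_and]
  tauto

/-- Every edge of `H` lies on a cycle of `H`. -/
theorem exists_walk_Hgraph (hC : C.IsCycle) (hI : IsIsolating G C)
    (hab : s(a, b) ∈ (Hgraph C).edgeSet) :
    ∃ p : G.Walk a b, ∀ e ∈ p.edges, e ∈ (Hgraph C).edgeSet \ {s(a, b)} := by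
  have key : ∀ v a, v ∉ C.support → G.Adj v a →
      ∃ p : G.Walk v a, ∀ e ∈ p.edges, e ∈ (Hgraph C).edgeSet \ {s(v, a)} := by
    intro v a hv hva
    obtain ⟨hcard, hsupp⟩ := hI v hv
    obtain ⟨a', ha', hne⟩ := Finset.exists_mem_ne (by omega) a
      (s := Finset.univ.filter fun w => G.Adj v w)
    simp only [Finset.mem_filter, Finset.mem_univ, true_and] at ha'
    obtain ⟨p, hp⟩ := exists_walk_of_mem_support (hsupp a' ha') (hsupp a hva)
    refine ⟨p.cons ha', fun e he => ?_⟩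
    rw [Walk.edges_cons, List.mem_cons] at he
    rcases he with rfl | he
    · exact ⟨mem_edgeSet_Hgraph.2 ⟨ha', Or.inr ⟨v, by simp, hv⟩⟩, fun h => hne (Sym2.congr_right.1 h)⟩
    · refine ⟨mem_edgeSet_Hgraph_of_mem_edges (hp e he), ?_⟩
      rintro rfl
      exact hv (C.fst_mem_support_of_mem_edges (hp _ he))
  rcases exists_eq_of_mem_edgeSet_Hgraph hab with h | ⟨v, w, h, hv, hvw⟩
  · rw [Sym2.eq_swap] at h
    obtain ⟨p, -, -, -, -, hp⟩ := exists_isPath_of_mem_edges hC h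
    refine ⟨p, fun e he => ⟨mem_edgeSet_Hgraph_of_mem_edges (hp e he).1, ?_⟩⟩
    rw [Sym2.eq_swap]
    exact (hp e he).2
  · obtain ⟨p, hp⟩ := key v w hv hvw
    rcases Sym2.eq_iff.1 h with ⟨rfl, rfl⟩ | ⟨rfl, rfl⟩
    · exact ⟨p, hp⟩
    · refine ⟨p.reverse, fun e he => ?_⟩
      rw [Sym2.eq_swap]
      exact hp e (by simpa using he)

end Longest

section Faces

variable {V : Type*} {G : SimpleGraph V} {emb : PlaneEmbedding G} {x a b c d v w : V}
  {C : G.Walk x x} {f g : Set (ℝ × ℝ)} {e : Sym2 V}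

/-- `f` is a face of `H`, and no vertex off `C` other than `v` is incident with `f`. -/
structure MinorAt (emb : PlaneEmbedding G) (C : G.Walk x x) (f : Set (ℝ × ℝ)) (v : V) : Prop where
  isFaceOf : IsFaceOf (drawingH emb C) f
  notMem : v ∉ C.support
  eq_of_incVertex : ∀ w, w ∉ C.support → incVertex emb f w → w = v

theorem MinorAt.mem_edges_or (hf : MinorAt emb C f v) (he : e ∈ (Hgraph C).edgeSet)
    (hfe : incEdge emb f e) : e ∈ C.edges ∨ ∃ a, e = s(v, a) ∧ G.Adj v a := by
  obtain h | ⟨w, a, rfl, hw, hwa⟩ := exists_eq_of_mem_edgeSet_Hgraph he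
  · exact Or.inl h
  · obtain rfl := hf.eq_of_incVertex w hw (incVertex_of_incEdge hwa hfe (Sym2.mem_mk_left w a))
    exact Or.inr ⟨a, rfl, hwa⟩

/-- A minor 2-face, whose cycle edges are `ab` and `bc`, at the vertex `v` off the cycle. -/
structure TwoFaceAt (emb : PlaneEmbedding G) (C : G.Walk x x) (f : Set (ℝ × ℝ)) (v a b c : V) :
    Prop extends MinorAt emb C f v where
  ne : a ≠ c
  fst_mem : s(a, b) ∈ C.edges
  snd_mem : s(b, c) ∈ C.edges
  inc_fst : incEdge emb f s(a, b)
  inc_snd : incEdge emb f s(b, c)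
  eq_or_eq : ∀ e ∈ C.edges, incEdge emb f e → e = s(a, b) ∨ e = s(b, c)
  adj_fst : G.Adj v a
  adj_snd : G.Adj v c

/-- A minor 3-face, whose cycle edges are `ab`, `bc` and `cd`, at the vertex `v` off the cycle. -/
structure ThreeFaceAt (emb : PlaneEmbedding G) (C : G.Walk x x) (f : Set (ℝ × ℝ))
    (v a b c d : V) : Prop extends MinorAt emb C f v where
  ne_fst : a ≠ c
  ne_snd : b ≠ d
  fst_mem : s(a, b) ∈ C.edges
  mid_mem : s(b, c) ∈ C.edges
  snd_mem : s(c, d) ∈ C.edges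
  inc_fst : incEdge emb f s(a, b)
  inc_mid : incEdge emb f s(b, c)
  inc_snd : incEdge emb f s(c, d)
  eq_or_eq : ∀ e ∈ C.edges, incEdge emb f e → e = s(a, b) ∨ e = s(b, c) ∨ e = s(c, d)
  adj_fst : G.Adj v a
  adj_snd : G.Adj v d

theorem TwoFaceAt.symm (h : TwoFaceAt emb C f v a b c) : TwoFaceAt emb C f v c b a := by
  obtain ⟨h, h1, h2, h3, h4, h5, h6, h7, h8⟩ := h
  rw [Sym2.eq_swap] at h2 h3 h4 h5
  refine ⟨h, h1.symm, h3, h2, h5, h4, fun e he hfe => ?_, h8, h7⟩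
  rw [Sym2.eq_swap (a := c) (b := b), Sym2.eq_swap (a := b) (b := a)]
  exact (h6 e he hfe).symm

theorem ThreeFaceAt.symm (h : ThreeFaceAt emb C f v a b c d) : ThreeFaceAt emb C f v d c b a := by
  obtain ⟨h, h1, h1', h2, h2', h3, h4, h4', h5, h6, h7, h8⟩ := h
  rw [Sym2.eq_swap] at h2 h2' h3 h4 h4' h5
  refine ⟨h, h1'.symm, h1.symm, h3, h2', h2, h5, h4', h4, fun e he hfe => ?_, h8, h7⟩
  rw [Sym2.eq_swap (a := d) (b := c), Sym2.eq_swap (a := c) (b := b),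
    Sym2.eq_swap (a := b) (b := a)]
  rcases h6 e he hfe with h | h | h <;> simp [h]

theorem mem_filter_incEdge :
    e ∈ (C.edges.toFinset.filter fun e => incEdge emb f e) ↔ e ∈ C.edges ∧ incEdge emb f e := by
  rw [Finset.mem_filter, List.mem_toFinset]

variable [Fintype V]

/-- Every edge of `H` is incident with two faces. -/
theorem exists_ne_incEdge_Hgraph (hC : C.IsCycle) (hI : IsIsolating G C)
    (hf : IsFaceOf (drawingH emb C) f) (he : e ∈ (Hgraph C).edgeSet) (hfe : incEdge emb f e) :
    ∃ g, IsFaceOf (drawingH emb C) g ∧ incEdge emb g e ∧ g ≠ f := by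
  induction e with | _ a b
  rw [drawingH_eq] at hf ⊢
  obtain ⟨p, hp⟩ := exists_walk_Hgraph hC hI he
  exact exists_ne_incEdge (Hgraph_edgeSet_subset C) he p hp hf hfe

/-- A face of `H` incident with an edge is incident with a further edge at each of its ends. -/
theorem exists_incEdge_ne_Hgraph (hC : C.IsCycle) (hI : IsIsolating G C)
    (hf : IsFaceOf (drawingH emb C) f) (he : e ∈ (Hgraph C).edgeSet) (hfe : incEdge emb f e)
    (ha : a ∈ e) : ∃ e' ∈ (Hgraph C).edgeSet, e' ≠ e ∧ a ∈ e' ∧ incEdge emb f e' := by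
  obtain ⟨g, hg, hge, hgf⟩ := exists_ne_incEdge_Hgraph hC hI hf he hfe
  rw [drawingH_eq] at hf hg
  exact exists_ne_incEdge_of_mem (Hgraph_edgeSet_subset C) hf hg hgf he hfe hge ha

theorem exists_minorAt (hf : MinorFaceH emb C f) : ∃ v, MinorAt emb C f v := by
  obtain ⟨hf, v, ⟨hv, -⟩, huniq⟩ := hf
  exact ⟨v, hf, (mem_Vminus_union_Vplus emb C).1 hv, fun w hw hfw =>
    huniq w ⟨(mem_Vminus_union_Vplus emb C).2 hw, hfw⟩⟩

namespace MinorAt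

/-- The boundary of a minor face leaves an end of a cycle edge along the cycle or to the vertex off
the cycle. -/
theorem exists_mem_edges_or_adj (hf : MinorAt emb C f v) (hC : C.IsCycle) (hI : IsIsolating G C)
    (hab : s(a, b) ∈ C.edges) (hfab : incEdge emb f s(a, b)) :
    (∃ c, c ≠ a ∧ s(b, c) ∈ C.edges ∧ incEdge emb f s(b, c)) ∨ G.Adj v b := by
  obtain ⟨e, he, hne, ⟨c, rfl⟩, hfe⟩ := exists_incEdge_ne_Hgraph hC hI hf.isFaceOf
    (mem_edgeSet_Hgraph_of_mem_edges hab) hfab (Sym2.mem_mk_right a b)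
  rcases hf.mem_edges_or he hfe with h | ⟨w, h, hvw⟩
  · exact Or.inl ⟨c, fun hca => hne (by rw [hca, Sym2.eq_swap]), h, hfe⟩
  · right
    rcases Sym2.eq_iff.1 h with ⟨rfl, rfl⟩ | ⟨rfl, rfl⟩
    · exact (hf.notMem (C.snd_mem_support_of_mem_edges hab)).elim
    · exact hvw

theorem exists_mem_edges_of_incVertex (hf : MinorAt emb C f v) (hC : C.IsCycle)
    (hI : IsIsolating G C) (hw : w ∈ C.support) (hfw : incVertex emb f w) :
    ∃ u, s(w, u) ∈ C.edges ∧ incEdge emb f s(w, u) := by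
  have hvw : w ≠ v := ne_of_mem_of_not_mem hw hf.notMem
  obtain ⟨e₀, he₀, hwe₀⟩ : ∃ e ∈ C.edges, w ∈ e :=
    (C.mem_support_iff_exists_mem_edges_of_not_nil hC.not_nil).1 hw
  have hface := hf.isFaceOf
  rw [drawingH_eq] at hface
  obtain ⟨e, he, hwe, hfe⟩ := exists_incEdge_of_incVertex (Hgraph_edgeSet_subset C) hface hfw
    (mem_edgeSet_Hgraph_of_mem_edges he₀) hwe₀
  obtain ⟨e', he', hne, hwe', hfe'⟩ := exists_incEdge_ne_Hgraph hC hI hf.isFaceOf he hfe hwe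
  rcases hf.mem_edges_or he hfe with h | ⟨u, rfl, -⟩
  · obtain ⟨u, rfl⟩ := hwe
    exact ⟨u, h, hfe⟩
  rcases hf.mem_edges_or he' hfe' with h | ⟨u', rfl, -⟩
  · obtain ⟨u, rfl⟩ := hwe'
    exact ⟨u, h, hfe'⟩
  rw [Sym2.mem_iff, or_iff_right hvw] at hwe hwe'
  exact (hne (by rw [← hwe, ← hwe'])).elim

/-- If two minor faces meet at a cycle vertex along both incident cycle edges, then all neighbours
of this vertex are incident with one of the two faces. -/
theorem incVertex_or_incVertex (hf : MinorAt emb C f v) (hg : MinorAt emb C g w) (hne : f ≠ g)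
    (hC : C.IsCycle) (hab : s(a, b) ∈ C.edges) (hbc : s(b, c) ∈ C.edges) (hac : a ≠ c)
    (hfab : incEdge emb f s(a, b)) (hfbc : incEdge emb f s(b, c)) (hgab : incEdge emb g s(a, b))
    (hgbc : incEdge emb g s(b, c)) (hvb : ¬ G.Adj v b) (hwb : ¬ G.Adj w b) {u : V}
    (hbu : G.Adj b u) : incVertex emb f u ∨ incVertex emb g u := by
  have hbC := C.fst_mem_support_of_mem_edges hbc
  set T := (Hgraph C).edgeSet
  set T₀ := {e ∈ T | incEdge emb f e ∨ incEdge emb g e}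
  have hT : T ⊆ G.edgeSet := Hgraph_edgeSet_subset C
  have hT₀ : T₀ ⊆ G.edgeSet := fun e he => hT he.1
  have hab' : s(a, b) ∈ T₀ := ⟨mem_edgeSet_Hgraph_of_mem_edges hab, Or.inl hfab⟩
  have hbc' : s(b, c) ∈ T₀ := ⟨mem_edgeSet_Hgraph_of_mem_edges hbc, Or.inl hfbc⟩
  have hcyc : ∀ u, s(b, u) ∈ C.edges → s(b, u) = s(a, b) ∨ s(b, u) = s(b, c) := fun u hu => by
    rcases eq_of_mem_edges hC hab hbc hac hu with rfl | rfl
    exacts [Or.inl Sym2.eq_swap, Or.inr rfl]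
  have hspoke : ∀ v, v ∉ C.support → ¬ G.Adj v b → ∀ u y, G.Adj v y → s(b, u) ≠ s(v, y) := by
    intro v hv hvb u y hvy h
    rcases Sym2.eq_iff.1 h with ⟨rfl, -⟩ | ⟨rfl, -⟩
    exacts [hv hbC, hvb hvy]
  have hstar : ∀ u, s(b, u) ∈ T₀ → s(b, u) = s(a, b) ∨ s(b, u) = s(b, c) := by
    rintro u ⟨hu, hfu | hgu⟩
    · rcases hf.mem_edges_or hu hfu with h | ⟨y, h, hvy⟩
      exacts [hcyc u h, (hspoke v hf.notMem hvb u y hvy h).elim]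
    · rcases hg.mem_edges_or hu hgu with h | ⟨y, h, hwy⟩
      exacts [hcyc u h, (hspoke w hg.notMem hwb u y hwy h).elim]
  have huG : s(b, u) ∈ G.edgeSet := hbu
  by_cases hu : s(b, u) ∈ T₀
  · exact hu.2.imp (fun h => incVertex_of_incEdge huG h (Sym2.mem_mk_right b u))
      fun h => incVertex_of_incEdge huG h (Sym2.mem_mk_right b u)
  have hff := hf.isFaceOf
  have hgf := hg.isFaceOf
  rw [drawingH_eq] at hff hgf
  have hf₀ : IsFaceOf (drawing emb T₀) f :=
    isFaceOf_drawing_mono hT (fun e he => he.1) hff fun e he h => ⟨he, Or.inl h⟩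
  have hg₀ : IsFaceOf (drawing emb T₀) g :=
    isFaceOf_drawing_mono hT (fun e he => he.1) hgf fun e he h => ⟨he, Or.inr h⟩
  obtain ⟨h, hh, hhu⟩ := exists_isFaceOf_incEdge hT₀ huG hu
  have hhb := incVertex_of_incEdge huG hhu (Sym2.mem_mk_left b u)
  obtain ⟨e, he, ⟨y, rfl⟩, hhe⟩ :=
    exists_incEdge_of_incVertex hT₀ hh hhb hbc' (Sym2.mem_mk_left b c)
  have : h = f ∨ h = g := by
    rcases hstar y he with hy | hy <;> rw [hy] at hhe
    · exact eq_or_eq_of_incEdge hT₀ hab' hf₀ hg₀ hh hfab hgab hhe hne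
    · exact eq_or_eq_of_incEdge hT₀ hbc' hf₀ hg₀ hh hfbc hgbc hhe hne
  rcases this with rfl | rfl
  · exact Or.inl (incVertex_of_incEdge huG hhu (Sym2.mem_mk_right b u))
  · exact Or.inr (incVertex_of_incEdge huG hhu (Sym2.mem_mk_right b u))

end MinorAt

theorem TwoFaceAt.not_adj (h : TwoFaceAt emb C f v a b c) (hC : IsLongestIsolatingCycle G C) :
    ¬ G.Adj v b :=
  not_adj_of_adj hC h.fst_mem h.notMem h.adj_fst

theorem TwoFaceAt.eq_of_incVertex_of_mem (h : TwoFaceAt emb C f v a b c)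
    (hC : IsLongestIsolatingCycle G C) (hw : w ∈ C.support) (hfw : incVertex emb f w) :
    w = a ∨ w = b ∨ w = c := by
  obtain ⟨u, hu, hfu⟩ := h.toMinorAt.exists_mem_edges_of_incVertex hC.1 hC.2.1 hw hfw
  have hmem := Sym2.mem_mk_left w u
  rcases h.eq_or_eq _ hu hfu with h' | h' <;> rw [h', Sym2.mem_iff] at hmem <;> tauto

theorem ThreeFaceAt.eq_of_incVertex_of_mem (h : ThreeFaceAt emb C f v a b c d)
    (hC : IsLongestIsolatingCycle G C) (hw : w ∈ C.support) (hfw : incVertex emb f w) :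
    w = a ∨ w = b ∨ w = c ∨ w = d := by
  obtain ⟨u, hu, hfu⟩ := h.toMinorAt.exists_mem_edges_of_incVertex hC.1 hC.2.1 hw hfw
  have hmem := Sym2.mem_mk_left w u
  rcases h.eq_or_eq _ hu hfu with h' | h' | h' <;> rw [h', Sym2.mem_iff] at hmem <;> tauto

theorem exists_twoFaceAt (hC : IsLongestIsolatingCycle G C) (hf : MinorFaceH emb C f)
    (hf2 : numCEdges emb C f = 2) : ∃ v a b c, TwoFaceAt emb C f v a b c := by
  obtain ⟨v, hv⟩ := exists_minorAt hf
  suffices ∃ a b c, c ≠ a ∧ s(a, b) ∈ C.edges ∧ incEdge emb f s(a, b) ∧ s(b, c) ∈ C.edges ∧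
      incEdge emb f s(b, c) by
    obtain ⟨a, b, c, hca, hab, hfab, hbc, hfbc⟩ := this
    have hne : s(a, b) ≠ s(b, c) := fun h => by
      rw [Sym2.eq_swap] at h
      exact hca (Sym2.congr_right.1 h).symm
    have heq : ({s(a, b), s(b, c)} : Finset (Sym2 V)) =
        C.edges.toFinset.filter fun e => incEdge emb f e := by
      refine Finset.eq_of_subset_of_card_le (fun e he => ?_) ?_
      · rw [Finset.mem_insert, Finset.mem_singleton] at he
        rw [mem_filter_incEdge]
        rcases he with rfl | rfl
        exacts [⟨hab, hfab⟩, ⟨hbc, hfbc⟩]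
      · rw [Finset.card_pair hne]
        exact hf2.le
    have heq' : ∀ e ∈ C.edges, incEdge emb f e → e = s(a, b) ∨ e = s(b, c) := fun e he hfe => by
      have := mem_filter_incEdge.2 ⟨he, hfe⟩
      rwa [← heq, Finset.mem_insert, Finset.mem_singleton] at this
    have key : ∀ a b c, c ≠ a → s(a, b) ∈ C.edges → incEdge emb f s(a, b) →
        (∀ e ∈ C.edges, incEdge emb f e → e = s(a, b) ∨ e = s(b, c)) → G.Adj v a := by
      intro a b c hca hab hfab heq
      have hadj := C.adj_of_mem_edges hab
      rw [Sym2.eq_swap] at hab hfab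
      refine (hv.exists_mem_edges_or_adj hC.1 hC.2.1 hab hfab).resolve_left ?_
      rintro ⟨d, hdb, had, hfad⟩
      have hmem := Sym2.mem_mk_left a d
      rcases heq _ had hfad with h | h
      · exact hdb (Sym2.congr_right.1 h)
      · rw [h, Sym2.mem_iff] at hmem
        exact hmem.elim hadj.ne hca.symm
    refine ⟨v, a, b, c, hv, hca.symm, hab, hbc, hfab, hfbc, heq', key a b c hca hab hfab heq', ?_⟩
    rw [Sym2.eq_swap] at hbc hfbc
    refine key c b a hca.symm hbc hfbc fun e he hfe => ?_
    rw [Sym2.eq_swap (a := c) (b := b), Sym2.eq_swap (a := b) (b := a)]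
    exact (heq' e he hfe).symm
  obtain ⟨e, he⟩ : (C.edges.toFinset.filter fun e => incEdge emb f e).Nonempty :=
    Finset.card_pos.1 (by change 0 < numCEdges emb C f; omega)
  rw [mem_filter_incEdge] at he
  induction e with | _ a b
  obtain ⟨hab, hfab⟩ := he
  rcases hv.exists_mem_edges_or_adj hC.1 hC.2.1 hab hfab with ⟨c, hca, hbc, hfbc⟩ | hvb
  · exact ⟨a, b, c, hca, hab, hfab, hbc, hfbc⟩
  rw [Sym2.eq_swap] at hab hfab
  rcases hv.exists_mem_edges_or_adj hC.1 hC.2.1 hab hfab with ⟨c, hca, hbc, hfbc⟩ | hva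
  · exact ⟨b, a, c, hca, hab, hfab, hbc, hfbc⟩
  · exact (not_adj_of_adj hC hab hv.notMem hvb hva).elim

theorem exists_threeFaceAt (hC : IsLongestIsolatingCycle G C) (hc : 4 ≤ C.length)
    (hf : MinorFaceH emb C f) (hf3 : numCEdges emb C f = 3) (he : IsMiddleCEdge emb C f e) :
    ∃ v a b c d, e = s(b, c) ∧ ThreeFaceAt emb C f v a b c d := by
  obtain ⟨v, hv⟩ := exists_minorAt hf
  obtain ⟨he, hfe, hmid⟩ := he
  induction e with | _ b c
  have hbc := C.adj_of_mem_edges he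
  obtain ⟨e₁, e₂, h₁, h₂, hne₁, hne₂, h₁₂, heq⟩ : ∃ e₁ e₂, (e₁ ∈ C.edges ∧ incEdge emb f e₁) ∧
      (e₂ ∈ C.edges ∧ incEdge emb f e₂) ∧ e₁ ≠ s(b, c) ∧ e₂ ≠ s(b, c) ∧ e₁ ≠ e₂ ∧
      ∀ e ∈ C.edges, incEdge emb f e → e = e₁ ∨ e = s(b, c) ∨ e = e₂ := by
    have hcard : ((C.edges.toFinset.filter fun e => incEdge emb f e).erase s(b, c)).card = 2 := by
      rw [Finset.card_erase_of_mem (mem_filter_incEdge.2 ⟨he, hfe⟩)]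
      change numCEdges emb C f - 1 = 2
      omega
    obtain ⟨e₁, e₂, h₁₂, h⟩ := Finset.card_eq_two.1 hcard
    have hiff : ∀ e, (e ≠ s(b, c) ∧ e ∈ C.edges ∧ incEdge emb f e) ↔ e = e₁ ∨ e = e₂ := fun e => by
      rw [← mem_filter_incEdge, ← Finset.mem_erase, h, Finset.mem_insert, Finset.mem_singleton]
    have h1 := (hiff e₁).2 (Or.inl rfl)
    have h2 := (hiff e₂).2 (Or.inr rfl)
    refine ⟨e₁, e₂, h1.2, h2.2, h1.1, h2.1, h₁₂, fun e he hfe => ?_⟩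
    have := hiff e
    tauto
  have hends : ∀ e ∈ C.edges, incEdge emb f e → e ≠ s(b, c) → b ∈ e ∨ c ∈ e := by
    intro e he hfe hne
    obtain ⟨u, hu, hue⟩ := hmid e he hfe hne
    rcases Sym2.mem_iff.1 hu with rfl | rfl
    exacts [Or.inl hue, Or.inr hue]
  have huniq : ∀ b c e e', s(b, c) ∈ C.edges → e ∈ C.edges → e' ∈ C.edges → e ≠ s(b, c) →
      e' ≠ s(b, c) → b ∈ e → b ∈ e' → e = e' := by
    rintro b c _ _ hbc he he' hne hne' ⟨u, rfl⟩ ⟨u', rfl⟩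
    rw [Sym2.eq_swap] at hbc
    have huc : u ≠ c := fun h => hne (by rw [h])
    have huc' : u' ≠ c := fun h => hne' (by rw [h])
    rw [(eq_of_mem_edges hC.1 hbc he huc.symm he').resolve_left huc']
  have heS : s(c, b) ∈ C.edges := by rwa [Sym2.eq_swap]
  obtain ⟨a, d, hab, hcd, hfab, hfcd, hac, hbd, heq⟩ : ∃ a d, s(a, b) ∈ C.edges ∧
      s(c, d) ∈ C.edges ∧ incEdge emb f s(a, b) ∧ incEdge emb f s(c, d) ∧ a ≠ c ∧ b ≠ d ∧
      ∀ e ∈ C.edges, incEdge emb f e → e = s(a, b) ∨ e = s(b, c) ∨ e = s(c, d) := by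
    have main : ∀ e₁ e₂, (e₁ ∈ C.edges ∧ incEdge emb f e₁) → (e₂ ∈ C.edges ∧ incEdge emb f e₂) →
        e₁ ≠ s(b, c) → e₂ ≠ s(b, c) → b ∈ e₁ → c ∈ e₂ →
        (∀ e ∈ C.edges, incEdge emb f e → e = e₁ ∨ e = s(b, c) ∨ e = e₂) →
        ∃ a d, s(a, b) ∈ C.edges ∧
      s(c, d) ∈ C.edges ∧ incEdge emb f s(a, b) ∧ incEdge emb f s(c, d) ∧ a ≠ c ∧ b ≠ d ∧
      ∀ e ∈ C.edges, incEdge emb f e → e = s(a, b) ∨ e = s(b, c) ∨ e = s(c, d) := by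
      rintro _ _ ⟨h₁, h₁'⟩ ⟨h₂, h₂'⟩ hne₁ hne₂ ⟨a, rfl⟩ ⟨d, rfl⟩ heq
      refine ⟨a, d, ?_⟩
      rw [Sym2.eq_swap (a := a)]
      refine ⟨h₁, h₂, h₁', h₂', fun h => hne₁ (by rw [h]), fun h => hne₂ ?_, heq⟩
      rw [h, Sym2.eq_swap]
    have hne₁' := hne₁
    have hne₂' := hne₂
    rw [Sym2.eq_swap] at hne₁' hne₂'
    rcases hends e₁ h₁.1 h₁.2 hne₁ with hb₁ | hc₁ <;>
      rcases hends e₂ h₂.1 h₂.2 hne₂ with hb₂ | hc₂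
    · exact (h₁₂ (huniq b c e₁ e₂ he h₁.1 h₂.1 hne₁ hne₂ hb₁ hb₂)).elim
    · exact main e₁ e₂ h₁ h₂ hne₁ hne₂ hb₁ hc₂ heq
    · exact main e₂ e₁ h₂ h₁ hne₂ hne₁ hb₂ hc₁ fun e he hfe => by
        have := heq e he hfe
        tauto
    · exact (h₁₂ (huniq c b e₁ e₂ heS h₁.1 h₂.1 hne₁' hne₂' hc₁ hc₂)).elim
  have had : a ≠ d := by
    obtain ⟨q, hq, hql, -⟩ := exists_isPath_of_three_edges hC.1 hab he hcd hac hbd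
    rintro rfl
    have := Walk.length_eq_zero_iff.2 (Walk.isPath_iff_nil.1 hq)
    omega
  have key : ∀ a b c d, s(a, b) ∈ C.edges → incEdge emb f s(a, b) → a ≠ c → a ≠ d →
      (∀ e ∈ C.edges, incEdge emb f e → e = s(a, b) ∨ e = s(b, c) ∨ e = s(c, d)) →
      G.Adj v a := by
    intro a b c d hab hfab hac had heq
    have hadj := C.adj_of_mem_edges hab
    rw [Sym2.eq_swap] at hab hfab
    refine (hv.exists_mem_edges_or_adj hC.1 hC.2.1 hab hfab).resolve_left ?_
    rintro ⟨u, hub, hau, hfau⟩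
    have hmem := Sym2.mem_mk_left a u
    rcases heq _ hau hfau with h | h | h
    · exact hub (Sym2.congr_right.1 h)
    · rw [h, Sym2.mem_iff] at hmem
      exact hmem.elim hadj.ne hac
    · rw [h, Sym2.mem_iff] at hmem
      exact hmem.elim hac had
  refine ⟨v, a, b, c, d, rfl, hv, hac, hbd, hab, he, hcd, hfab, hfe, hfcd, heq,
    key a b c d hab hfab hac had heq, ?_⟩
  rw [Sym2.eq_swap] at hcd hfcd
  refine key d c b a hcd hfcd hbd.symm had.symm fun e he hfe => ?_
  rw [Sym2.eq_swap (a := d) (b := c), Sym2.eq_swap (a := c) (b := b),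
    Sym2.eq_swap (a := b) (b := a)]
  rcases heq e he hfe with h | h | h <;> simp [h]

end Faces

section Discharging

variable {V : Type*} [Fintype V] {G : SimpleGraph V} {emb : PlaneEmbedding G}
  {x a b c d u v w y z : V} {C : G.Walk x x} {f g : Set (ℝ × ℝ)} {e : Sym2 V}

theorem TwoFaceAt.eq_of_twoFaceAt (hf : TwoFaceAt emb C f v a b c) (hG : ThreeConnected G)
    (hC : IsLongestIsolatingCycle G C) (hg : TwoFaceAt emb C g w a b c) : f = g := by
  by_contra hne
  obtain ⟨u, hbu, hua, huc⟩ := exists_adj_ne_ne hG (C.adj_of_mem_edges hf.fst_mem).ne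
    (C.adj_of_mem_edges hf.snd_mem).ne'
  rcases hf.toMinorAt.incVertex_or_incVertex hg.toMinorAt hne hC.1 hf.fst_mem hf.snd_mem hf.ne
    hf.inc_fst hf.inc_snd hg.inc_fst hg.inc_snd (hf.not_adj hC) (hg.not_adj hC) hbu with h | h
  all_goals by_cases hu : u ∈ C.support
  · rcases hf.eq_of_incVertex_of_mem hC hu h with rfl | rfl | rfl
    exacts [hua rfl, hbu.ne rfl, huc rfl]
  · exact hf.not_adj hC (hf.eq_of_incVertex u hu h ▸ hbu.symm)
  · rcases hg.eq_of_incVertex_of_mem hC hu h with rfl | rfl | rfl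
    exacts [hua rfl, hbu.ne rfl, huc rfl]
  · exact hg.not_adj hC (hg.eq_of_incVertex u hu h ▸ hbu.symm)

/-- Two distinct minor 2-faces have no common cycle edge. -/
theorem TwoFaceAt.eq_of_incEdge (hf : TwoFaceAt emb C f v a b c) (hG : ThreeConnected G)
    (hC : IsLongestIsolatingCycle G C) (hg : TwoFaceAt emb C g w u y z) (he : e ∈ C.edges)
    (hfe : incEdge emb f e) (hge : incEdge emb g e) : f = g := by
  have key : ∀ a c p q, TwoFaceAt emb C f v a b c → TwoFaceAt emb C g w p y q →
      s(b, c) = s(y, q) → f = g := by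
    intro a c p q hf hg h
    rcases Sym2.eq_iff.1 h with ⟨rfl, rfl⟩ | ⟨rfl, rfl⟩
    · have hbp := hg.fst_mem
      rw [Sym2.eq_swap] at hbp
      obtain rfl := (eq_of_mem_edges hC.1 hf.fst_mem hf.snd_mem hf.ne hbp).resolve_right hg.ne
      exact hf.eq_of_twoFaceAt hG hC hg
    · exact (not_crossing_spokes hC hf.fst_mem hg.symm.fst_mem hg.symm.snd_mem hf.ne hg.ne.symm
        hf.notMem hg.notMem hf.adj_fst hf.adj_snd hg.adj_snd hg.adj_fst).elim
  have swap : ∀ {p q : V}, s(p, q) = s(q, p) := Sym2.eq_swap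
  rcases hf.eq_or_eq e he hfe with h | h <;> rcases hg.eq_or_eq e he hge with h' | h'
  · exact key c a z u hf.symm hg.symm (swap.trans (h.symm.trans (h'.trans swap)))
  · exact key c a u z hf.symm hg (swap.trans (h.symm.trans h'))
  · exact key a c z u hf hg.symm (h.symm.trans (h'.trans swap))
  · exact key a c u z hf hg (h.symm.trans h')

theorem TwoFaceAt.eq_of_threeFaceAt (hf : TwoFaceAt emb C f v b c z) (hG : ThreeConnected G)
    (hC : IsLongestIsolatingCycle G C) (hg : ThreeFaceAt emb C g w a b c d) : f = g := by
  by_contra hne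
  obtain rfl : z = d :=
    (eq_of_mem_edges hC.1 hg.mid_mem hg.snd_mem hg.ne_snd hf.snd_mem).resolve_left hf.ne.symm
  have hwc : ¬ G.Adj w c := not_adj_of_adj hC (Sym2.eq_swap ▸ hg.snd_mem) hg.notMem hg.adj_snd
  obtain ⟨u, hcu, hub, hud⟩ := exists_adj_ne_ne hG (C.adj_of_mem_edges hf.fst_mem).ne
    (C.adj_of_mem_edges hf.snd_mem).ne'
  rcases hf.toMinorAt.incVertex_or_incVertex hg.toMinorAt hne hC.1 hf.fst_mem hf.snd_mem hf.ne
    hf.inc_fst hf.inc_snd hg.inc_mid hg.inc_snd (hf.not_adj hC) hwc hcu with h | h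
  all_goals by_cases hu : u ∈ C.support
  · rcases hf.eq_of_incVertex_of_mem hC hu h with rfl | rfl | rfl
    exacts [hub rfl, hcu.ne rfl, hud rfl]
  · exact hf.not_adj hC (hf.eq_of_incVertex u hu h ▸ hcu.symm)
  · rcases hg.eq_of_incVertex_of_mem hC hu h with rfl | rfl | rfl | rfl
    · exact not_adj_of_spokes hC hg.fst_mem hg.mid_mem hg.snd_mem hg.ne_fst hg.ne_snd hf.notMem
        hf.adj_fst hf.adj_snd hcu.symm
    exacts [hub rfl, hcu.ne rfl, hud rfl]
  · exact hwc (hg.eq_of_incVertex u hu h ▸ hcu.symm)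

/-- The middle cycle edge of a minor 3-face is not incident with a minor 2-face. -/
theorem TwoFaceAt.eq_of_incEdge_mid (hf : TwoFaceAt emb C f v u y z) (hG : ThreeConnected G)
    (hC : IsLongestIsolatingCycle G C) (hg : ThreeFaceAt emb C g w a b c d)
    (hfe : incEdge emb f s(b, c)) : f = g := by
  have key : ∀ u z, TwoFaceAt emb C f v u y z → s(b, c) = s(u, y) → f = g := by
    intro u z hf h
    rcases Sym2.eq_iff.1 h with ⟨rfl, rfl⟩ | ⟨rfl, rfl⟩
    exacts [hf.eq_of_threeFaceAt hG hC hg, hf.eq_of_threeFaceAt hG hC hg.symm]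
  rcases hf.eq_or_eq _ hg.mid_mem hfe with h | h
  exacts [key u z hf h, key z u hf.symm (h.trans Sym2.eq_swap)]

theorem sendWeight_eq_zero (hG : ThreeConnected G) (hC : IsLongestIsolatingCycle G C)
    (hc : 4 ≤ C.length) (hf : MinorFaceH emb C f) (hf2 : numCEdges emb C f = 2)
    (g : Set (ℝ × ℝ)) : sendWeight emb C f g = 0 := by
  obtain ⟨v, a, b, c, hv⟩ := exists_twoFaceAt hC hf hf2
  have h1 : ¬ MajorFaceH emb C f := fun h => h.2 hf
  have h4 : ¬ 4 ≤ numCEdges emb C f := by omega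
  rw [sendWeight, if_neg (fun h => h1 h.1), if_neg, if_neg, if_neg (fun h => h4 h.2.1),
    if_neg (fun h => h4 h.2.1)]
  · norm_num
  · rintro ⟨-, hg, hg3, hne, e, he, hfe⟩
    obtain ⟨w, a', b', c', d', rfl, hw⟩ := exists_threeFaceAt hC hc hg hg3 he
    exact hne (hv.eq_of_incEdge_mid hG hC hw hfe)
  · rintro ⟨-, hg, hg2, hne, e, he, hfe, hge⟩
    obtain ⟨w, a', b', c', hw⟩ := exists_twoFaceAt hC hg hg2
    exact hne (hv.eq_of_incEdge hG hC hw he hfe hge)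

theorem le_sendWeight (hf : MinorFaceH emb C f) (hf2 : numCEdges emb C f = 2)
    (hg : IsFaceOf (drawingH emb C) g) (h : OppositeFaces emb C g f) :
    2 / 3 * (mEdges emb C g f : ℚ) ≤ sendWeight emb C g f := by
  unfold sendWeight
  have hm : (0 : ℚ) ≤ mEdges emb C g f := Nat.cast_nonneg _
  by_cases hgm : MinorFaceH emb C g
  · rw [if_pos (show MinorFaceH emb C g ∧ MinorFaceH emb C f ∧ numCEdges emb C f = 2 ∧
      OppositeFaces emb C g f from ⟨hgm, hf, hf2, h⟩)]
    split_ifs <;> linarith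
  · rw [if_pos (show MajorFaceH emb C g ∧ MinorFaceH emb C f ∧ OppositeFaces emb C g f from
      ⟨⟨hg, hgm⟩, hf, h⟩)]
    split_ifs <;> linarith

theorem isFaceOf_of_sendWeight_ne_zero (hf2 : numCEdges emb C f = 2)
    (h : sendWeight emb C g f ≠ 0) : IsFaceOf (drawingH emb C) g ∧ OppositeFaces emb C g f := by
  by_contra hn
  refine h ?_
  rw [sendWeight, if_neg (fun h => hn ⟨h.1.1, h.2.2⟩), if_neg (fun h => hn ⟨h.1.1, h.2.2.2⟩),
    if_neg (fun h => by omega), if_neg (fun h => by omega), if_neg (fun h => by omega)]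
  norm_num

theorem four_thirds_le_finsum_sendWeight (hC : IsLongestIsolatingCycle G C)
    (hf : MinorFaceH emb C f) (hf2 : numCEdges emb C f = 2) :
    (4 : ℚ) / 3 ≤ ∑ᶠ g, sendWeight emb C g f := by
  obtain ⟨e₁, e₂, hne, heq⟩ := Finset.card_eq_two.1 hf2
  have hmem : ∀ e, e ∈ C.edges ∧ incEdge emb f e ↔ e = e₁ ∨ e = e₂ := fun e => by
    rw [← mem_filter_incEdge, heq, Finset.mem_insert, Finset.mem_singleton]
  obtain ⟨h₁, hf₁⟩ := (hmem e₁).2 (Or.inl rfl)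
  obtain ⟨h₂, hf₂⟩ := (hmem e₂).2 (Or.inr rfl)
  obtain ⟨g₁, hg₁, hge₁, hgf₁⟩ := exists_ne_incEdge_Hgraph hC.1 hC.2.1 hf.1
    (mem_edgeSet_Hgraph_of_mem_edges h₁) hf₁
  obtain ⟨g₂, hg₂, hge₂, hgf₂⟩ := exists_ne_incEdge_Hgraph hC.1 hC.2.1 hf.1
    (mem_edgeSet_Hgraph_of_mem_edges h₂) hf₂
  have hsupp : (fun g => sendWeight emb C g f).support ⊆ (({g₁, g₂} : Finset _) : Set _) := by
    intro g hg
    obtain ⟨hg, hgf, e, he, hge, hfe⟩ := isFaceOf_of_sendWeight_ne_zero hf2 hg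
    have hff := hf.1
    rw [drawingH_eq] at hg hff hg₁ hg₂
    have heH := mem_edgeSet_Hgraph_of_mem_edges he
    rw [Finset.coe_insert, Finset.coe_singleton, mem_insert_iff, mem_singleton_iff]
    rcases (hmem e).1 ⟨he, hfe⟩ with rfl | rfl
    · exact Or.inl ((eq_or_eq_of_incEdge (Hgraph_edgeSet_subset C) heH hff hg₁ hg hf₁ hge₁ hge
        hgf₁.symm).resolve_left hgf)
    · exact Or.inr ((eq_or_eq_of_incEdge (Hgraph_edgeSet_subset C) heH hff hg₂ hg hf₂ hge₂ hge
        hgf₂.symm).resolve_left hgf)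
  rw [finsum_eq_sum_of_support_subset _ hsupp]
  have hs₁ := le_sendWeight hf hf2 hg₁ ⟨hgf₁, e₁, h₁, hge₁, hf₁⟩
  have hs₂ := le_sendWeight hf hf2 hg₂ ⟨hgf₂, e₂, h₂, hge₂, hf₂⟩
  by_cases hg : g₁ = g₂
  · subst hg
    have hm : 2 ≤ mEdges emb C g₁ f := by
      rw [← Finset.card_pair hne]
      refine Finset.card_le_card fun e he => ?_
      rw [Finset.mem_insert, Finset.mem_singleton] at he
      rw [Finset.mem_filter, List.mem_toFinset]
      rcases he with rfl | rfl
      exacts [⟨h₁, hge₁, hf₁⟩, ⟨h₂, hge₂, hf₂⟩]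
    have hm' : (2 : ℚ) ≤ mEdges emb C g₁ f := by exact_mod_cast hm
    rw [Finset.pair_eq_singleton, Finset.sum_singleton]
    linarith
  · have hpos : ∀ g e, e ∈ C.edges → incEdge emb g e → incEdge emb f e →
        (1 : ℚ) ≤ mEdges emb C g f := by
      intro g e he hge hfe
      have : 0 < mEdges emb C g f := Finset.card_pos.2 ⟨e, by
        rw [Finset.mem_filter, List.mem_toFinset]
        exact ⟨he, hge, hfe⟩⟩
      exact_mod_cast this
    have hm₁ := hpos g₁ e₁ h₁ hge₁ hf₁
    have hm₂ := hpos g₂ e₂ h₂ hge₂ hf₂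
    rw [Finset.sum_pair hg]
    linarith

end Discharging

end PlaneTopology

/-- After discharging by rules R1–R5, every minor 2-face of `H` has weight `≥ 10/3`. -/
theorem stmt8_minor_2face
    {V : Type*} [Fintype V] {G : SimpleGraph V}
    (hn : 11 ≤ Fintype.card V) (h4 : EssentiallyFourConnected G)
    (emb : PlaneEmbedding G) {x : V} (C : G.Walk x x)
    (hC : IsLongestIsolatingCycle G C) (hc : 8 ≤ C.length)
    (hVm : (Vminus emb C).Nonempty) (hVp : (Vplus emb C).Nonempty) :
    ∀ f : Set (ℝ × ℝ), MinorFaceH emb C f → numCEdges emb C f = 2 →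
      (10 : ℚ) / 3 ≤ wFace emb C f := by
  intro f hf hf2
  have hin := PlaneTopology.four_thirds_le_finsum_sendWeight hC hf hf2
  rw [wFace, finsum_congr (PlaneTopology.sendWeight_eq_zero h4.1 hC (by omega) hf hf2),
    finsum_zero, hf2]
  push_cast
  linarith

end
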